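/- arXiv:math/0109180 — 5 statements merged into one kernel-verified Lean document; each statement's English description precedes it below -/
import Mathlib

section
/- There exists ε₀ > 0 depending only on n with the following property. Let 0 < ε < ε₀, let p ≥ 1 be an integer, and let f : 𝔹(1) → ℂⁿ be a C^p map with |f|_{1,1} < ε. Then there exists a C^p map g : 𝔹(1−2ε) → ℂⁿ such that: (a) z + g(z) ∈ 𝔹(1) for every z ∈ 𝔹(1−2ε); (b) g(z) + f(z + g(z)) = 0 for every z ∈ 𝔹(1−2ε), i.e. F(z + g(z)) = z where F = id + f; and (c) for all integers s, k with 0 ≤ s ≤ k and k + s ≤ p there exist a constant C > 0 and an exponent N ∈ ℕ, depending only on n and k, such that |g|_{1−2ε,k} ≤ C·(1 + |f|_{1,k})^N·|f|_{1,k} and |g|_{1−2ε,k+s} ≤ C·(1 + |f|_{1,k})^N·|f|_{1,k+s}. -/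
open scoped ENNReal

/-- Iterated partial derivative `∂^J u` of a scalar function on `ℝ^d`, the
multi-index `J` being recorded as a list of coordinate directions. -/
noncomputable def partialDeriv {d : ℕ} : List (Fin d) → ((Fin d → ℝ) → ℝ) → ((Fin d → ℝ) → ℝ)
  | [], u => u
  | j :: L, u => fun x => fderiv ℝ (partialDeriv L u) x (Pi.single j 1)

/-- `|f|_{r,k}`: the supremum over `z` in the sup-norm ball `𝔹(r)`, over components `i`, and
over multi-indices `J` with `|J| ≤ k`, of `|∂^J f_i(z)|` (valued in `[0,∞]`). -/
noncomputable def CnormBall {d : ℕ} (f : (Fin d → ℝ) → (Fin d → ℝ)) (r : ℝ) (k : ℕ) : ℝ≥0∞ :=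
  ⨆ z ∈ Metric.ball (0 : Fin d → ℝ) r, ⨆ i : Fin d,
    ⨆ L : {L : List (Fin d) // L.length ≤ k},
      ENNReal.ofReal |partialDeriv L.1 (fun x => f x i) z|

namespace OrderedFinpartition

lemma sum_partSize {m : ℕ} (c : OrderedFinpartition m) : ∑ i, c.partSize i = m := by
  simpa using c.sum_sigma_eq_sum (fun _ : Fin m ↦ (1 : ℕ))

lemma partSize_add_length_le {m : ℕ} (c : OrderedFinpartition m) (i : Fin c.length) :
    c.partSize i + c.length ≤ m + 1 := by
  have h := c.sum_partSize
  rw [← Finset.add_sum_erase _ _ (Finset.mem_univ i)] at h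
  have h2 : ∑ _j ∈ Finset.univ.erase i, 1 ≤ ∑ j ∈ Finset.univ.erase i, c.partSize j :=
    Finset.sum_le_sum fun j _ ↦ c.partSize_pos j
  have := i.2
  simp at h2
  omega

lemma partSize_add_partSize_le {m : ℕ} (c : OrderedFinpartition m) {i j : Fin c.length}
    (hij : i ≠ j) : c.partSize i + c.partSize j ≤ m := by
  calc c.partSize i + c.partSize j = ∑ l ∈ {i, j}, c.partSize l := (Finset.sum_pair hij).symm
    _ ≤ ∑ l, c.partSize l := Finset.sum_le_sum_of_subset (Finset.subset_univ _)
    _ = m := c.sum_partSize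

lemma eq_of_length_eq_one {m : ℕ} {c c' : OrderedFinpartition m} (h : c.length = 1)
    (h' : c'.length = 1) : c = c' := by
  have key : ∀ c : OrderedFinpartition m, c.length = 1 → ∀ i, c.partSize i = m := by
    intro c hc i
    refine le_antisymm (c.partSize_le i) ?_
    have : Subsingleton (Fin c.length) := by rw [hc]; infer_instance
    calc m = ∑ j, c.partSize j := c.sum_partSize.symm
      _ ≤ c.partSize i := by simp [Subsingleton.elim _ i, hc]
  have k := key c h
  have k' := key c' h'
  rcases c with ⟨length, partSize, _, emb, hemb, _, _, _⟩
  rcases c' with ⟨length', partSize', _, emb', hemb', _, _, _⟩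
  dsimp only at h h' k k' hemb hemb'
  subst h
  subst h'
  obtain rfl : partSize = fun _ ↦ m := funext k
  obtain rfl : partSize' = fun _ ↦ m := funext k'
  have hid : ∀ e : Fin m → Fin m, StrictMono e → e = id := fun e he ↦
    congrArg (fun g : Fin m ≃o Fin m ↦ (g : Fin m → Fin m)) <| Subsingleton.elim
      (he.orderIsoOfSurjective e (Finite.injective_iff_surjective.1 he.injective))
      (OrderIso.refl (Fin m))
  obtain rfl : emb = fun _ ↦ id := funext fun i ↦ hid _ (hemb i)
  obtain rfl : emb' = fun _ ↦ id := funext fun i ↦ hid _ (hemb' i)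
  rfl

end OrderedFinpartition

/-- The terms of the Faà di Bruno formula of order `m` in which the outer function is
differentiated at least twice, evaluated on sequences of bounds. -/
noncomputable def faaDiBrunoRemainder (m : ℕ) (a y : ℕ → ℝ) : ℝ :=
  ∑ c : OrderedFinpartition m with 2 ≤ c.length, a c.length * ∏ i, y (c.partSize i)

lemma OrderedFinpartition.mul_prod_le {k m : ℕ} (c : OrderedFinpartition m) (hc : 2 ≤ c.length)
    (hm : m ≤ 2 * k) {A B P : ℝ} {a y : ℕ → ℝ} (hA : 0 ≤ A) (hB : 0 ≤ B) (hP : 1 ≤ P)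
    (hy0 : ∀ j, 0 ≤ y j)
    (ha : ∀ j ≤ k, a j ≤ A) (hb : ∀ j ≤ m, a j ≤ B)
    (hy : ∀ j, 1 ≤ j → j ≤ k → j < m → y j ≤ P)
    (hyB : ∀ j, k < j → j < m → y j ≤ P * B) :
    a c.length * ∏ i, y (c.partSize i) ≤ (1 + A) * P ^ m * B := by
  have hlt : ∀ i, c.partSize i < m := fun i ↦ by
    have := c.partSize_add_length_le i
    omega
  by_cases h : ∃ i, k < c.partSize i
  · obtain ⟨i, hi⟩ := h
    have hlen : c.length ≤ k := by
      have := c.partSize_add_length_le i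
      omega
    have hprod : ∏ j ∈ Finset.univ.erase i, y (c.partSize j) ≤ P ^ (c.length - 1) := by
      calc _ ≤ ∏ _j ∈ Finset.univ.erase i, P := by
            refine Finset.prod_le_prod (fun _ _ ↦ hy0 _) fun j hj ↦ ?_
            refine hy _ (c.partSize_pos j) ?_ (hlt j)
            have := c.partSize_add_partSize_le (Finset.ne_of_mem_erase hj)
            omega
        _ = P ^ (c.length - 1) := by simp
    rw [← Finset.mul_prod_erase _ _ (Finset.mem_univ i)]
    calc _ ≤ (1 + A) * ((P * B) * P ^ (c.length - 1)) := by
          refine mul_le_mul ((ha _ hlen).trans (by linarith)) ?_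
            (mul_nonneg (hy0 _) (Finset.prod_nonneg fun _ _ ↦ hy0 _)) (by linarith)
          exact mul_le_mul (hyB _ hi (hlt i)) hprod (Finset.prod_nonneg fun _ _ ↦ hy0 _)
            (by positivity)
      _ = (1 + A) * P ^ (c.length - 1 + 1) * B := by ring
      _ ≤ (1 + A) * P ^ m * B := by
          have := c.length_le
          gcongr
          omega
  · push Not at h
    calc _ ≤ ((1 + A) * B) * P ^ c.length := by
          refine mul_le_mul ((hb _ c.length_le).trans (by nlinarith)) ?_
            (Finset.prod_nonneg fun _ _ ↦ hy0 _) (by positivity)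
          calc _ ≤ ∏ _j : Fin c.length, P := Finset.prod_le_prod (fun _ _ ↦ hy0 _)
                fun j _ ↦ hy _ (c.partSize_pos j) (h j) (hlt j)
            _ = P ^ c.length := by simp
      _ = (1 + A) * P ^ c.length * B := by ring
      _ ≤ (1 + A) * P ^ m * B := by
          gcongr
          exact c.length_le

lemma faaDiBrunoRemainder_le {k m : ℕ} (hm : m ≤ 2 * k) {A B P : ℝ} {a y : ℕ → ℝ}
    (hA : 0 ≤ A) (hB : 0 ≤ B) (hP : 1 ≤ P) (hy0 : ∀ j, 0 ≤ y j)
    (ha : ∀ j ≤ k, a j ≤ A) (hb : ∀ j ≤ m, a j ≤ B)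
    (hy : ∀ j, 1 ≤ j → j ≤ k → j < m → y j ≤ P)
    (hyB : ∀ j, k < j → j < m → y j ≤ P * B) :
    faaDiBrunoRemainder m a y ≤
      Fintype.card (OrderedFinpartition m) * ((1 + A) * P ^ m * B) := by
  calc faaDiBrunoRemainder m a y
      ≤ ∑ c : OrderedFinpartition m with 2 ≤ c.length, (1 + A) * P ^ m * B :=
        Finset.sum_le_sum fun c hc ↦ c.mul_prod_le (Finset.mem_filter.1 hc).2 hm hA hB hP hy0
          ha hb hy hyB
    _ ≤ ∑ _c : OrderedFinpartition m, (1 + A) * P ^ m * B :=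
        Finset.sum_le_sum_of_subset_of_nonneg (Finset.subset_univ _) fun _ _ _ ↦ by positivity
    _ = _ := by simp

/-- Sequences `x, y` controlled by the Faà di Bruno recursion grow tamely in terms of `a`. -/
lemma exists_tame_bound_of_recursion (k n : ℕ) :
    ∃ (C : ℝ) (N : ℕ), 1 ≤ C ∧ ∀ (s : ℕ) (A B : ℝ) (a x y : ℕ → ℝ), s ≤ k → 0 ≤ A → 0 ≤ B →
      (∀ j, 0 ≤ y j) →
      (∀ j ≤ k, a j ≤ A) → (∀ j ≤ k + s, a j ≤ B) →
      x 0 ≤ a 0 → x 1 ≤ 2 * a 1 → y 1 ≤ 2 → (∀ m, 2 ≤ m → m ≤ k + s → y m ≤ x m) →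
      (∀ m, 2 ≤ m → m ≤ k + s → x m ≤ 2 * faaDiBrunoRemainder m a y) →
      ∀ m ≤ n, m ≤ k + s → x m ≤ C * (1 + A) ^ N * B := by
  induction n with
  | zero =>
    refine ⟨1, 0, le_rfl, ?_⟩
    intro s A B a x y _ _ _ _ _ hb hx0 _ _ _ _ m hm _
    obtain rfl : m = 0 := by omega
    simpa using hx0.trans (hb 0 (by omega))
  | succ n ih =>
    obtain ⟨C, N, hC, ih⟩ := ih
    set K : ℝ := ((Fintype.card (OrderedFinpartition (n + 1)) : ℕ) : ℝ) with hK
    have hK0 : 0 ≤ K := by positivity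
    refine ⟨C + 2 + 2 * K * (2 * C) ^ (n + 1), N + (1 + (N + 1) * (n + 1)), ?_, ?_⟩
    · have : 0 ≤ 2 * K * (2 * C) ^ (n + 1) := by positivity
      linarith
    intro s A B a x y hs hA hB hy0 ha hb hx0 hx1 hy1 hyx hrec m hm hmk
    have h1A : 1 ≤ 1 + A := by linarith
    have hxB : ∀ j ≤ n, j ≤ k + s → x j ≤ C * (1 + A) ^ N * B :=
      ih s A B a x y hs hA hB hy0 ha hb hx0 hx1 hy1 hyx hrec
    have hxA : ∀ j ≤ n, j ≤ k → x j ≤ C * (1 + A) ^ N * A :=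
      ih 0 A A a x y (Nat.zero_le _) hA hA hy0 ha ha hx0 hx1 hy1
        (fun m h h' ↦ hyx m h (by omega)) fun m h h' ↦ hrec m h (by omega)
    have hmono : ∀ (c : ℝ) (M : ℕ), 0 ≤ c → c ≤ C + 2 + 2 * K * (2 * C) ^ (n + 1) →
        M ≤ N + (1 + (N + 1) * (n + 1)) →
        c * (1 + A) ^ M * B ≤
          (C + 2 + 2 * K * (2 * C) ^ (n + 1)) * (1 + A) ^ (N + (1 + (N + 1) * (n + 1))) * B := by
      intro c M hc hcC hM
      gcongr
    have hpos : 0 ≤ 2 * K * (2 * C) ^ (n + 1) := by positivity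
    rcases Nat.lt_or_ge n m with hnm | hnm
    · obtain rfl : m = n + 1 := by omega
      rcases Nat.eq_zero_or_pos n with rfl | hn
      · refine le_trans ?_ (hmono 2 0 (by norm_num) (by linarith) (by omega))
        have := hb 1 (by omega)
        simp only [zero_add, pow_zero, mul_one]
        linarith
      · set P : ℝ := 2 * C * (1 + A) ^ (N + 1) with hPdef
        have hpow : 1 ≤ (1 + A) ^ (N + 1) := one_le_pow₀ h1A
        have hpowN : 1 ≤ (1 + A) ^ N := one_le_pow₀ h1A
        have hP2 : 2 ≤ P := by nlinarith
        have hCP : C * (1 + A) ^ N * (1 + A) ≤ P := by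
          rw [hPdef, pow_succ]
          have : 0 ≤ C * ((1 + A) ^ N * (1 + A)) := by positivity
          linarith
        have hCN : 0 ≤ C * (1 + A) ^ N := by positivity
        refine (hrec (n + 1) (by omega) hmk).trans ?_
        have := faaDiBrunoRemainder_le (k := k) (m := n + 1) (by omega) hA hB
          (by linarith : 1 ≤ P) hy0 ha (fun j hj ↦ hb j (by omega))
          (fun j h1 hjk hjn ↦ by
            rcases Nat.lt_or_ge 1 j with h | h
            · have := (hyx j h (by omega)).trans (hxA j (by omega) hjk)
              nlinarith
            · obtain rfl : j = 1 := by omega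
              linarith)
          (fun j hkj hjn ↦ by
            have h := (hyx j (by omega) (by omega)).trans (hxB j (by omega) (by omega))
            refine h.trans (mul_le_mul_of_nonneg_right ?_ hB)
            nlinarith)
        rw [← hK] at this
        refine le_trans (mul_le_mul_of_nonneg_left this (by norm_num)) ?_
        refine le_trans (le_of_eq ?_) (hmono (2 * K * (2 * C) ^ (n + 1))
          (1 + (N + 1) * (n + 1)) hpos (by linarith) (by omega))
        rw [hPdef, mul_pow, ← pow_mul, pow_add, pow_one]
        ring
    · exact (hxB m hnm hmk).trans (hmono C N (by linarith) (by linarith) (by omega))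

section PartialDerivatives

variable {d : ℕ} {f : (Fin d → ℝ) → (Fin d → ℝ)} {U : Set (Fin d → ℝ)} {p : ℕ}

lemma partialDeriv_eq_iteratedFDeriv {u : (Fin d → ℝ) → ℝ} (hU : IsOpen U)
    (hu : ContDiffOn ℝ p u U) (L : List (Fin d)) (hL : L.length ≤ p) :
    ∀ x ∈ U, partialDeriv L u x =
      iteratedFDeriv ℝ L.length u x fun i ↦ Pi.single (L.get i) 1 := by
  induction L with
  | nil => intro x _; simp [partialDeriv]
  | cons j L ih =>
    intro x hx
    have hev : partialDeriv L u =ᶠ[nhds x] fun x ↦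
        iteratedFDeriv ℝ L.length u x fun i ↦ Pi.single (L.get i) 1 :=
      Filter.eventually_of_mem (hU.mem_nhds hx) (ih (by simp at hL; omega))
    have hd : DifferentiableAt ℝ (iteratedFDeriv ℝ L.length u) x :=
      (hu.contDiffAt (hU.mem_nhds hx)).differentiableAt_iteratedFDeriv
        (by exact_mod_cast hL)
    change fderiv ℝ (partialDeriv L u) x (Pi.single j 1) = _
    rw [hev.fderiv_eq, fderiv_continuousMultilinear_apply_const_apply hd]
    rfl

lemma partialDeriv_comp_eq_iteratedFDeriv (hU : IsOpen U) (hf : ContDiffOn ℝ p f U)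
    (L : List (Fin d)) (hL : L.length ≤ p) {x : Fin d → ℝ} (hx : x ∈ U) (i : Fin d) :
    partialDeriv L (fun x ↦ f x i) x =
      iteratedFDeriv ℝ L.length f x (fun l ↦ Pi.single (L.get l) 1) i := by
  rw [partialDeriv_eq_iteratedFDeriv hU (contDiffOn_pi.1 hf i) L hL x hx]
  change iteratedFDeriv ℝ L.length
    ((ContinuousLinearMap.proj (R := ℝ) (φ := fun _ : Fin d ↦ ℝ) i) ∘ f) x _ = _
  rw [ContinuousLinearMap.iteratedFDeriv_comp_left _ (hf.contDiffAt (hU.mem_nhds hx))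
    (by exact_mod_cast hL)]
  rfl

lemma abs_partialDeriv_le_norm_iteratedFDeriv (hU : IsOpen U) (hf : ContDiffOn ℝ p f U)
    (L : List (Fin d)) (hL : L.length ≤ p) {x : Fin d → ℝ} (hx : x ∈ U) (i : Fin d) :
    |partialDeriv L (fun x ↦ f x i) x| ≤ ‖iteratedFDeriv ℝ L.length f x‖ := by
  rw [partialDeriv_comp_eq_iteratedFDeriv hU hf L hL hx i, ← Real.norm_eq_abs]
  refine (norm_le_pi_norm _ i).trans ?_
  refine (ContinuousMultilinearMap.le_opNorm _ _).trans ?_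
  simp [Pi.norm_single]

lemma ContinuousMultilinearMap.norm_le_of_forall_single {m : ℕ} {F : Type*}
    [NormedAddCommGroup F] [NormedSpace ℝ F]
    (T : ContinuousMultilinearMap ℝ (fun _ : Fin m ↦ Fin d → ℝ) F) {S : ℝ} (hS : 0 ≤ S)
    (h : ∀ r : Fin m → Fin d, ‖T fun i ↦ Pi.single (r i) 1‖ ≤ S) : ‖T‖ ≤ d ^ m * S := by
  refine ContinuousMultilinearMap.opNorm_le_bound (by positivity) fun v ↦ ?_
  have hv : v = fun i ↦ ∑ j, v i j • (Pi.single j 1 : Fin d → ℝ) := by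
    funext i
    exact pi_eq_sum_univ' (v i)
  calc ‖T v‖ = ‖∑ r : Fin m → Fin d, (∏ i, v i (r i)) • T fun i ↦ Pi.single (r i) 1‖ := by
        conv_lhs => rw [hv]
        rw [T.map_sum]
        simp_rw [T.map_smul_univ]
    _ ≤ ∑ _r : Fin m → Fin d, (∏ i, ‖v i‖) * S := by
        refine norm_sum_le_of_le _ fun r _ ↦ ?_
        rw [norm_smul, norm_prod]
        exact mul_le_mul (Finset.prod_le_prod (fun _ _ ↦ norm_nonneg _)
          fun i _ ↦ norm_le_pi_norm (v i) (r i)) (h r) (norm_nonneg _)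
          (Finset.prod_nonneg fun _ _ ↦ norm_nonneg _)
    _ = d ^ m * S * ∏ i, ‖v i‖ := by
        simp
        ring

lemma ofReal_abs_partialDeriv_le_CnormBall {r : ℝ} {k : ℕ} {x : Fin d → ℝ}
    (hx : x ∈ Metric.ball 0 r) (i : Fin d) (L : List (Fin d)) (hL : L.length ≤ k) :
    ENNReal.ofReal |partialDeriv L (fun x ↦ f x i) x| ≤ CnormBall f r k :=
  (le_iSup (fun L : {L : List (Fin d) // L.length ≤ k} ↦
    ENNReal.ofReal |partialDeriv L.1 (fun x ↦ f x i) x|) ⟨L, hL⟩).trans <|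
  (le_iSup (fun i : Fin d ↦ ⨆ L : {L : List (Fin d) // L.length ≤ k},
    ENNReal.ofReal |partialDeriv L.1 (fun x ↦ f x i) x|) i).trans <|
  le_iSup₂_of_le x hx le_rfl

lemma CnormBall_mono {r : ℝ} {k l : ℕ} (h : k ≤ l) : CnormBall f r k ≤ CnormBall f r l :=
  iSup₂_le fun _ hz ↦ iSup_le fun i ↦ iSup_le fun L ↦
    ofReal_abs_partialDeriv_le_CnormBall hz i L.1 (L.2.trans h)

lemma norm_iteratedFDeriv_le_CnormBall {r : ℝ} (hf : ContDiffOn ℝ p f (Metric.ball 0 r))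
    {k m : ℕ} (hmk : m ≤ k) (hmp : m ≤ p) (hfin : CnormBall f r k ≠ ∞) {x : Fin d → ℝ}
    (hx : x ∈ Metric.ball 0 r) :
    ‖iteratedFDeriv ℝ m f x‖ ≤ d ^ m * (CnormBall f r k).toReal := by
  refine ContinuousMultilinearMap.norm_le_of_forall_single _ ENNReal.toReal_nonneg fun e ↦ ?_
  refine (pi_norm_le_iff_of_nonneg ENNReal.toReal_nonneg).2 fun i ↦ ?_
  have hlen : (List.ofFn e).length = m := List.length_ofFn
  have hget : ∀ l (hl : l = m) (v : Fin l → Fin d → ℝ), (∀ i, v i = Pi.single (e (i.cast hl)) 1) →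
      iteratedFDeriv ℝ l f x v = iteratedFDeriv ℝ m f x fun i ↦ Pi.single (e i) 1 := by
    rintro l rfl v hv
    congr 1
    exact funext hv
  have h := ofReal_abs_partialDeriv_le_CnormBall (f := f) hx i (List.ofFn e) (hlen.le.trans hmk)
  rw [partialDeriv_comp_eq_iteratedFDeriv Metric.isOpen_ball hf _ (hlen.le.trans hmp) hx,
    hget _ hlen _ (fun i ↦ by simp; rfl)] at h
  rw [Real.norm_eq_abs]
  exact (ENNReal.ofReal_le_iff_le_toReal hfin).1 h

lemma CnormBall_le_of_norm_iteratedFDeriv_le {r : ℝ} (hf : ContDiffOn ℝ p f (Metric.ball 0 r))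
    {k : ℕ} (hkp : k ≤ p) {S : ℝ}
    (h : ∀ x ∈ Metric.ball 0 r, ∀ m ≤ k, ‖iteratedFDeriv ℝ m f x‖ ≤ S) :
    CnormBall f r k ≤ ENNReal.ofReal S :=
  iSup₂_le fun x hx ↦ iSup_le fun i ↦ iSup_le fun L ↦ ENNReal.ofReal_le_ofReal <|
    (abs_partialDeriv_le_norm_iteratedFDeriv Metric.isOpen_ball hf L.1 (L.2.trans hkp) hx i).trans
      (h x hx _ L.2)

end PartialDerivatives

section FaaDiBruno

variable {E F G : Type*} [NormedAddCommGroup E] [NormedSpace ℝ E] [NormedAddCommGroup F]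
  [NormedSpace ℝ F] [NormedAddCommGroup G] [NormedSpace ℝ G]

lemma norm_iteratedFDeriv_comp_le_add_faaDiBrunoRemainder {f : F → G} {g : E → F} {x : E} {m : ℕ}
    (hm : 1 ≤ m) (hf : ContDiffAt ℝ m f (g x)) (hg : ContDiffAt ℝ m g x) :
    ‖iteratedFDeriv ℝ m (f ∘ g) x‖ ≤
      ‖iteratedFDeriv ℝ 1 f (g x)‖ * ‖iteratedFDeriv ℝ m g x‖ +
        faaDiBrunoRemainder m (fun j ↦ ‖iteratedFDeriv ℝ j f (g x)‖)
          (fun j ↦ ‖iteratedFDeriv ℝ j g x‖) := by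
  set a : ℕ → ℝ := fun j ↦ ‖iteratedFDeriv ℝ j f (g x)‖
  set y : ℕ → ℝ := fun j ↦ ‖iteratedFDeriv ℝ j g x‖
  have hterm : ∀ c : OrderedFinpartition m, 0 ≤ a c.length * ∏ i, y (c.partSize i) :=
    fun c ↦ mul_nonneg (norm_nonneg _) (Finset.prod_nonneg fun _ _ ↦ norm_nonneg _)
  have hone : ∑ c : OrderedFinpartition m with ¬ 2 ≤ c.length,
      a c.length * ∏ i, y (c.partSize i) ≤ a 1 * y m := by
    have hlen : ∀ c : OrderedFinpartition m, ¬ 2 ≤ c.length → c.length = 1 := fun c hc ↦ by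
      have := c.length_pos hm
      omega
    have hval : ∀ c : OrderedFinpartition m, c.length = 1 →
        a c.length * ∏ i, y (c.partSize i) = a 1 * y m := by
      intro c hc
      have hps : ∀ i, c.partSize i = m := fun i ↦ by
        have : Subsingleton (Fin c.length) := by rw [hc]; infer_instance
        conv_rhs => rw [← c.sum_partSize]
        simp [Subsingleton.elim _ i, hc]
      simp [hps, hc]
    have hcard : (Finset.univ.filter fun c : OrderedFinpartition m ↦ ¬ 2 ≤ c.length).card ≤ 1 :=
      Finset.card_le_one.2 fun c hc c' hc' ↦ OrderedFinpartition.eq_of_length_eq_one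
        (hlen c (Finset.mem_filter.1 hc).2) (hlen c' (Finset.mem_filter.1 hc').2)
    rw [Finset.sum_congr rfl fun c hc ↦ hval c (hlen c (Finset.mem_filter.1 hc).2),
      Finset.sum_const, nsmul_eq_mul]
    exact mul_le_of_le_one_left (mul_nonneg (norm_nonneg _) (norm_nonneg _))
      (by exact_mod_cast hcard)
  rw [iteratedFDeriv_comp hf hg le_rfl]
  calc _ ≤ ∑ c : OrderedFinpartition m, a c.length * ∏ i, y (c.partSize i) :=
        norm_sum_le_of_le _ fun c _ ↦ c.norm_compAlongOrderedFinpartition_le _ _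
    _ ≤ _ := by
        rw [← Finset.sum_filter_add_sum_filter_not _ (fun c ↦ 2 ≤ c.length), add_comm]
        exact add_le_add_left hone _

lemma iteratedFDeriv_id_eq_zero {m : ℕ} (hm : 2 ≤ m) (x : E) :
    iteratedFDeriv ℝ m (id : E → E) x = 0 := by
  obtain ⟨m, rfl⟩ := Nat.exists_eq_add_of_le' hm
  have hid : fderiv ℝ (id : E → E) = fun _ ↦ ContinuousLinearMap.id ℝ E := funext fun _ ↦ fderiv_id
  rw [← norm_eq_zero, ← norm_iteratedFDeriv_fderiv, hid, iteratedFDeriv_const_of_ne (by omega)]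
  simp

end FaaDiBruno

section LocalInverse

variable {E : Type*} [NormedAddCommGroup E] [NormedSpace ℝ E] [CompleteSpace E] [Nontrivial E]

lemma exists_contDiffOn_rightInverse_id_add {f : E → E} {p : ℕ} (hp : 1 ≤ p) {ε : ℝ} (hε : 0 < ε)
    (hf : ContDiffOn ℝ p f (Metric.ball 0 1)) (hf0 : ∀ x ∈ Metric.ball (0 : E) 1, ‖f x‖ ≤ ε)
    (hf1 : ∀ x ∈ Metric.ball (0 : E) 1, ‖fderiv ℝ f x‖ ≤ 1 / 4) :
    ∃ G : E → E, ContDiffOn ℝ p G (Metric.ball 0 (1 - 2 * ε)) ∧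
      ∀ z ∈ Metric.ball (0 : E) (1 - 2 * ε), G z ∈ Metric.ball (0 : E) 1 ∧ G z + f (G z) = z := by
  have hfat : ∀ x ∈ Metric.ball (0 : E) 1, ContDiffAt ℝ p f x :=
    fun x hx ↦ hf.contDiffAt (Metric.isOpen_ball.mem_nhds hx)
  have hdiff : ∀ x ∈ Metric.ball (0 : E) 1, DifferentiableAt ℝ f x :=
    fun x hx ↦ (hfat x hx).differentiableAt (by exact_mod_cast (by omega : p ≠ 0))
  have hlip : LipschitzOnWith (1 / 4) f (Metric.ball 0 1) :=
    (convex_ball 0 1).lipschitzOnWith_of_nnnorm_fderiv_le hdiff fun x hx ↦ by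
      rw [← NNReal.coe_le_coe]
      simpa using hf1 x hx
  let Φ : E → E := fun x ↦ x + f x
  have happ : ApproximatesLinearOn Φ (ContinuousLinearEquiv.refl ℝ E : E →L[ℝ] E)
      (Metric.ball 0 1) (1 / 4) := by
    intro x hx y hy
    have := hlip.norm_sub_le hx hy
    have hΦ : Φ x - Φ y - (ContinuousLinearEquiv.refl ℝ E : E →L[ℝ] E) (x - y) = f x - f y := by
      change x + f x - (y + f y) - (x - y) = _
      abel
    rwa [hΦ]
  have hnorm : ‖((ContinuousLinearEquiv.refl ℝ E).symm : E →L[ℝ] E)‖₊ = 1 := by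
    rw [← NNReal.coe_inj]
    exact ContinuousLinearMap.norm_id
  have hc : (1 / 4 : NNReal) < ‖((ContinuousLinearEquiv.refl ℝ E).symm : E →L[ℝ] E)‖₊⁻¹ := by
    rw [hnorm, inv_one, ← NNReal.coe_lt_coe]
    norm_num
  let e := happ.toOpenPartialHomeomorph Φ _ (Or.inr hc) Metric.isOpen_ball
  have htarget : Metric.ball (0 : E) (1 - 2 * ε) ⊆ e.target := by
    intro z hz
    rw [mem_ball_zero_iff] at hz
    have hsub : Metric.closedBall z (3 / 2 * ε) ⊆ Metric.ball 0 1 := fun w hw ↦ by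
      rw [mem_closedBall_iff_norm] at hw
      rw [mem_ball_zero_iff]
      have := norm_le_norm_add_norm_sub' w z
      linarith
    have hsurj := happ.closedBall_subset_target (Or.inr hc) Metric.isOpen_ball (b := z)
      (ε := 3 / 2 * ε) (by positivity) hsub
    apply hsurj
    rw [hnorm, mem_closedBall_iff_norm']
    have := hf0 z (by rw [mem_ball_zero_iff]; linarith)
    simp [Φ]
    linarith
  refine ⟨e.symm, fun z hz ↦ ContDiffAt.contDiffWithinAt ?_, fun z hz ↦
    ⟨e.map_target (htarget hz), e.right_inv (htarget hz)⟩⟩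
  have hGz : e.symm z ∈ Metric.ball (0 : E) 1 := e.map_target (htarget hz)
  have hsmall : ‖-fderiv ℝ f (e.symm z)‖ < 1 := by
    rw [norm_neg]
    exact (hf1 _ hGz).trans_lt (by norm_num)
  have hder : HasFDerivAt e (ContinuousLinearMap.id ℝ E + fderiv ℝ f (e.symm z)) (e.symm z) :=
    (hasFDerivAt_id _).add (hdiff _ hGz).hasFDerivAt
  have hequiv : ((ContinuousLinearEquiv.unitsEquiv ℝ E (Units.oneSub _ hsmall) : E ≃L[ℝ] E) :
      E →L[ℝ] E) = ContinuousLinearMap.id ℝ E + fderiv ℝ f (e.symm z) := by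
    ext v
    simp
  rw [← hequiv] at hder
  exact e.contDiffAt_symm (htarget hz) hder (contDiffAt_id.add (hfat _ hGz))

end LocalInverse

section Tame

variable {E : Type*} [NormedAddCommGroup E] [NormedSpace ℝ E]

/-- Local tame bounds for `g = G - id`, when `G` is a right inverse of `id + f`. -/
lemma exists_norm_iteratedFDeriv_le_of_rightInverse (k : ℕ) :
    ∃ (C : ℝ) (N : ℕ), 1 ≤ C ∧ ∀ (s p : ℕ) (A B : ℝ) (f g : E → E) (V : Set E), 1 ≤ p → s ≤ k →
      k + s ≤ p → IsOpen V → (∀ z ∈ V, ContDiffAt ℝ p g z) →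
      (∀ z ∈ V, ContDiffAt ℝ p f (z + g z)) → (∀ z ∈ V, g z + f (z + g z) = 0) →
      (∀ z ∈ V, ‖iteratedFDeriv ℝ 1 f (z + g z)‖ ≤ 1 / 4) →
      (∀ z ∈ V, ∀ j ≤ k, ‖iteratedFDeriv ℝ j f (z + g z)‖ ≤ A) →
      (∀ z ∈ V, ∀ j ≤ k + s, ‖iteratedFDeriv ℝ j f (z + g z)‖ ≤ B) →
      ∀ z ∈ V, ∀ m ≤ k + s, ‖iteratedFDeriv ℝ m g z‖ ≤ C * (1 + A) ^ N * B := by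
  obtain ⟨C, N, hC, h⟩ := exists_tame_bound_of_recursion k (2 * k)
  refine ⟨C, N, hC, ?_⟩
  intro s p A B f g V hp hs hks hV hg hf heq hf1 hA hB z hz m hm
  let G : E → E := id + g
  have hgG : g =ᶠ[nhds z] -(f ∘ G) := Filter.eventually_of_mem (hV.mem_nhds hz) fun w hw ↦
    eq_neg_of_add_eq_zero_left (heq w hw)
  have hnorm : ∀ m, ‖iteratedFDeriv ℝ m g z‖ = ‖iteratedFDeriv ℝ m (f ∘ G) z‖ := fun m ↦ by
    rw [(hgG.iteratedFDeriv ℝ m).eq_of_nhds, iteratedFDeriv_neg, Pi.neg_apply, norm_neg]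
  have hadd : ∀ m ≤ p, iteratedFDeriv ℝ m G z =
      iteratedFDeriv ℝ m (id : E → E) z + iteratedFDeriv ℝ m g z := fun m hm ↦
    iteratedFDeriv_add_apply contDiffAt_id ((hg z hz).of_le (by exact_mod_cast hm))
  have hG : ContDiffAt ℝ p G z := contDiffAt_id.add (hg z hz)
  have hrec : ∀ m, 1 ≤ m → m ≤ p → ‖iteratedFDeriv ℝ m g z‖ ≤
      ‖iteratedFDeriv ℝ 1 f (z + g z)‖ * ‖iteratedFDeriv ℝ m G z‖ +
        faaDiBrunoRemainder m (fun j ↦ ‖iteratedFDeriv ℝ j f (z + g z)‖)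
          (fun j ↦ ‖iteratedFDeriv ℝ j G z‖) := fun m h1 hm ↦ by
    rw [hnorm]
    exact norm_iteratedFDeriv_comp_le_add_faaDiBrunoRemainder h1
      ((hf z hz).of_le (by exact_mod_cast hm)) (hG.of_le (by exact_mod_cast hm))
  have hid1 : ‖iteratedFDeriv ℝ 1 (id : E → E) z‖ ≤ 1 := by
    rw [norm_iteratedFDeriv_one, fderiv_id]
    exact ContinuousLinearMap.norm_id_le
  have hG1 : ‖iteratedFDeriv ℝ 1 G z‖ ≤ 1 + ‖iteratedFDeriv ℝ 1 g z‖ := by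
    rw [hadd 1 hp]
    exact (norm_add_le _ _).trans (by linarith)
  have hrem1 : ∀ a y, faaDiBrunoRemainder 1 a y = 0 := fun a y ↦
    Finset.sum_eq_zero fun c hc ↦ by
      have := c.length_le
      have := (Finset.mem_filter.1 hc).2
      omega
  have hg1 := hrec 1 le_rfl hp
  rw [hrem1, add_zero] at hg1
  have h4 := hf1 z hz
  have hn1 := norm_nonneg (iteratedFDeriv ℝ 1 f (z + g z))
  have hn2 := norm_nonneg (iteratedFDeriv ℝ 1 g z)
  have hg1' : ‖iteratedFDeriv ℝ 1 g z‖ ≤ 2 * ‖iteratedFDeriv ℝ 1 f (z + g z)‖ := by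
    nlinarith
  refine h s A B (fun j ↦ ‖iteratedFDeriv ℝ j f (z + g z)‖) (fun j ↦ ‖iteratedFDeriv ℝ j g z‖)
    (fun j ↦ ‖iteratedFDeriv ℝ j G z‖) hs ((norm_nonneg _).trans (hA z hz 0 (by omega)))
    ((norm_nonneg _).trans (hB z hz 0 (by omega))) (fun _ ↦ norm_nonneg _)
    (hA z hz) (hB z hz) ?_ hg1' (by linarith) ?_ ?_ m (by omega) hm
  · rw [hnorm, norm_iteratedFDeriv_zero, norm_iteratedFDeriv_zero]
    rfl
  · intro m hm hmk
    rw [hadd m (hmk.trans hks), iteratedFDeriv_id_eq_zero hm, zero_add]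
  · intro m h2 hm
    have hy := hadd m (by omega)
    rw [iteratedFDeriv_id_eq_zero h2, zero_add] at hy
    have := hrec m (by omega) (by omega)
    rw [hy] at this
    have := norm_nonneg (iteratedFDeriv ℝ m g z)
    nlinarith

end Tame

/-- **Smooth local inverse of `id + f` with tame estimates.**
There is `ε₀ > 0` (depending only on `n`), and constants `C k > 0`, `N k` (depending only on
`n, k`), such that: for `0 < ε < ε₀`, `p ≥ 1` and a `C^p` map `f : 𝔹(1) → ℂⁿ ≅ ℝ^{2n}` with
`|f|_{1,1} < ε`, there is a `C^p` map `g` on `𝔹(1-2ε)` with `z + g z ∈ 𝔹(1)`,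
`g z + f (z + g z) = 0` (i.e. `F ∘ G = id` for `F = id + f`, `G = id + g`), and for all
`0 ≤ s ≤ k` with `k + s ≤ p`:
`|g|_{1-2ε,k} ≤ C k (1+|f|_{1,k})^{N k} |f|_{1,k}` and
`|g|_{1-2ε,k+s} ≤ C k (1+|f|_{1,k})^{N k} |f|_{1,k+s}`. -/
theorem exists_inverse_with_tame_estimates (n : ℕ) (hn : 1 ≤ n) :
    ∃ ε₀ > (0 : ℝ), ∃ C : ℕ → ℝ, ∃ N : ℕ → ℕ, (∀ k, 0 < C k) ∧
      ∀ ε : ℝ, 0 < ε → ε < ε₀ → ∀ p : ℕ, 1 ≤ p →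
        ∀ f : (Fin (2 * n) → ℝ) → (Fin (2 * n) → ℝ),
          ContDiffOn ℝ p f (Metric.ball 0 1) →
          CnormBall f 1 1 < ENNReal.ofReal ε →
          ∃ g : (Fin (2 * n) → ℝ) → (Fin (2 * n) → ℝ),
            ContDiffOn ℝ p g (Metric.ball 0 (1 - 2 * ε)) ∧
            (∀ z ∈ Metric.ball (0 : Fin (2 * n) → ℝ) (1 - 2 * ε),
              z + g z ∈ Metric.ball (0 : Fin (2 * n) → ℝ) 1) ∧
            (∀ z ∈ Metric.ball (0 : Fin (2 * n) → ℝ) (1 - 2 * ε), g z + f (z + g z) = 0) ∧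
            ∀ s k : ℕ, s ≤ k → k + s ≤ p →
              CnormBall g (1 - 2 * ε) k ≤
                ENNReal.ofReal (C k) * (1 + CnormBall f 1 k) ^ (N k) * CnormBall f 1 k ∧
              CnormBall g (1 - 2 * ε) (k + s) ≤
                ENNReal.ofReal (C k) * (1 + CnormBall f 1 k) ^ (N k) * CnormBall f 1 (k + s) := by
  have hd : 0 < 2 * n := by omega
  have : Nonempty (Fin (2 * n)) := ⟨⟨0, hd⟩⟩
  have hn0 : (0 : ℝ) < n := by exact_mod_cast hn
  have hd1 : (1 : ℝ) ≤ ((2 * n : ℕ) : ℝ) := by exact_mod_cast hd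
  choose C N hC hbound using exists_norm_iteratedFDeriv_le_of_rightInverse (E := Fin (2 * n) → ℝ)
  let K : ℕ → ℝ := fun k ↦ ((2 * n : ℕ) : ℝ) ^ (2 * k)
  have hK : ∀ k, 1 ≤ K k := fun k ↦ one_le_pow₀ hd1
  have hCpos : ∀ k, 0 < C k * K k ^ (N k + 1) := fun k ↦
    mul_pos (by linarith [hC k]) (pow_pos (by linarith [hK k]) _)
  refine ⟨1 / (8 * n), by positivity, fun k ↦ C k * K k ^ (N k + 1), N, hCpos, ?_⟩
  intro ε hε hεlt p hp f hf hfε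
  have hfin1 : CnormBall f 1 1 ≠ ∞ := hfε.ne_top
  have hle : (CnormBall f 1 1).toReal ≤ ε := ENNReal.toReal_le_of_le_ofReal hε.le hfε.le
  have hf0 : ∀ x ∈ Metric.ball (0 : Fin (2 * n) → ℝ) 1, ‖f x‖ ≤ ε := fun x hx ↦ by
    have := norm_iteratedFDeriv_le_CnormBall hf (Nat.zero_le 1) (Nat.zero_le p) hfin1 hx
    rw [norm_iteratedFDeriv_zero, pow_zero, one_mul] at this
    exact this.trans hle
  have hf1 : ∀ x ∈ Metric.ball (0 : Fin (2 * n) → ℝ) 1, ‖iteratedFDeriv ℝ 1 f x‖ ≤ 1 / 4 :=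
    fun x hx ↦ by
      have h := norm_iteratedFDeriv_le_CnormBall hf le_rfl hp hfin1 hx
      rw [lt_div_iff₀ (by positivity)] at hεlt
      rw [pow_one] at h
      push_cast at h
      nlinarith
  obtain ⟨G, hG, hGz⟩ := exists_contDiffOn_rightInverse_id_add hp hε hf hf0 fun x hx ↦ by
    rw [← norm_iteratedFDeriv_one]
    exact hf1 x hx
  have hadd : ∀ z, z + (G z - z) = G z := fun z ↦ add_sub_cancel _ _
  have hg : ContDiffOn ℝ p (fun z ↦ G z - z) (Metric.ball 0 (1 - 2 * ε)) := hG.sub contDiffOn_id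
  have heq : ∀ z ∈ Metric.ball (0 : Fin (2 * n) → ℝ) (1 - 2 * ε),
      (G z - z) + f (z + (G z - z)) = 0 := fun z hz ↦ by
    rw [hadd, sub_add_eq_add_sub, (hGz z hz).2, sub_self]
  have hmem : ∀ z ∈ Metric.ball (0 : Fin (2 * n) → ℝ) (1 - 2 * ε),
      z + (G z - z) ∈ Metric.ball (0 : Fin (2 * n) → ℝ) 1 := fun z hz ↦ by
    rw [hadd]
    exact (hGz z hz).1
  have main : ∀ s k : ℕ, s ≤ k → k + s ≤ p → CnormBall (fun z ↦ G z - z) (1 - 2 * ε) (k + s) ≤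
      ENNReal.ofReal (C k * K k ^ (N k + 1)) * (1 + CnormBall f 1 k) ^ N k *
        CnormBall f 1 (k + s) := by
    intro s k hs hks
    by_cases htop : CnormBall f 1 (k + s) = ∞
    · rw [htop, ENNReal.mul_top]
      · exact le_top
      · refine mul_ne_zero (by simpa using hCpos k) (pow_ne_zero _ ?_)
        exact (zero_lt_one.trans_le le_self_add).ne'
    have htop' : CnormBall f 1 k ≠ ∞ :=
      ((CnormBall_mono (Nat.le_add_right k s)).trans_lt (lt_top_iff_ne_top.2 htop)).ne
    set a := (CnormBall f 1 k).toReal with ha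
    set b := (CnormBall f 1 (k + s)).toReal with hb
    have ha0 : 0 ≤ a := ENNReal.toReal_nonneg
    have hb0 : 0 ≤ b := ENNReal.toReal_nonneg
    have hpow : ∀ j ≤ 2 * k, ((2 * n : ℕ) : ℝ) ^ j ≤ K k := fun j hj ↦ pow_le_pow_right₀ hd1 hj
    have hmain := hbound k s p (K k * a) (K k * b) f (fun z ↦ G z - z)
      (Metric.ball 0 (1 - 2 * ε)) hp hs hks Metric.isOpen_ball
      (fun z hz ↦ hg.contDiffAt (Metric.isOpen_ball.mem_nhds hz))
      (fun z hz ↦ hf.contDiffAt (Metric.isOpen_ball.mem_nhds (hmem z hz))) heq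
      (fun z hz ↦ hf1 _ (hmem z hz))
      (fun z hz j hj ↦ (norm_iteratedFDeriv_le_CnormBall hf hj (by omega) htop'
        (hmem z hz)).trans (mul_le_mul_of_nonneg_right (hpow j (by omega)) ha0))
      (fun z hz j hj ↦ (norm_iteratedFDeriv_le_CnormBall hf hj (by omega) htop
        (hmem z hz)).trans (mul_le_mul_of_nonneg_right (hpow j (by omega)) hb0))
    refine (CnormBall_le_of_norm_iteratedFDeriv_le hg hks hmain).trans ?_
    rw [← ENNReal.ofReal_toReal htop', ← ENNReal.ofReal_toReal htop, ← ha, ← hb,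
      ← ENNReal.ofReal_one, ← ENNReal.ofReal_add zero_le_one ha0,
      ← ENNReal.ofReal_pow (by linarith), ← ENNReal.ofReal_mul (hCpos k).le,
      ← ENNReal.ofReal_mul (mul_nonneg (hCpos k).le (by positivity))]
    refine ENNReal.ofReal_le_ofReal ?_
    have hK1 := hK k
    have hC1 := hC k
    calc C k * (1 + K k * a) ^ N k * (K k * b)
        ≤ C k * (K k * (1 + a)) ^ N k * (K k * b) := by
          gcongr
          linarith
      _ = C k * K k ^ (N k + 1) * (1 + a) ^ N k * b := by
          rw [mul_pow, pow_succ]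
          ring
  exact ⟨fun z ↦ G z - z, hg, hmem, heq, fun s k hs hks ↦
    ⟨main 0 k (Nat.zero_le k) (by omega), main s k hs hks⟩⟩
end

section
/- There exists δ > 0 (which may depend on n, m, p, φ⁽⁰⁾, V and 𝒰) with the following property. If |g|_{C^p(𝒰)} < δ and φ : V → ℝᵐ is any C^p map such that (φ(Y,W)+iY, W) ∈ 𝒰 and ρ_l(φ(Y,W)+iY, W) = 0 for all (Y,W) ∈ V and all l = 1,…,m, then for every integer k ≤ p−1 there exist a constant C > 0 and an exponent N ∈ ℕ, depending only on n, m and k, such that |φ − φ⁽⁰⁾|_{C^k(V)} ≤ C · (1 + |φ⁽⁰⁾|_{C^{k+1}(V′)})^N · |g|_{C^k(𝒰)}. (The factor 1 + |φ⁽⁰⁾|_{C^{k+1}(V′)} is, on bounded sets, comparable to the C^{k+1} norm of the defining functions ρ⁽⁰⁾.) -/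
open scoped ENNReal

/-- `‖u‖_{C^k(S)}`: the supremum over `x ∈ S` of the norms of the derivatives of `u`
of order at most `k`, taken within the set `S` (valued in `[0,∞]`). -/
noncomputable def CnormOn {E F : Type*} [NormedAddCommGroup E] [NormedSpace ℝ E]
    [NormedAddCommGroup F] [NormedSpace ℝ F]
    (u : E → F) (S : Set E) (k : ℕ) : ℝ≥0∞ :=
  ⨆ j : Fin (k + 1), ⨆ x ∈ S, ENNReal.ofReal ‖iteratedFDerivWithin ℝ j u S x‖

section Auxiliary

open Set

universe u

variable {E F G : Type u} [NormedAddCommGroup E] [NormedSpace ℝ E]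
  [NormedAddCommGroup F] [NormedSpace ℝ F] [NormedAddCommGroup G] [NormedSpace ℝ G]

theorem norm_iteratedFDerivWithin_add_le {f g : E → F} {s : Set E} {i : ℕ} {x : E}
    (hf : ContDiffOn ℝ i f s) (hg : ContDiffOn ℝ i g s) (hs : UniqueDiffOn ℝ s) (hx : x ∈ s) :
    ‖iteratedFDerivWithin ℝ i (fun y => f y + g y) s x‖ ≤
      ‖iteratedFDerivWithin ℝ i f s x‖ + ‖iteratedFDerivWithin ℝ i g s x‖ := by
  rw [fun_iteratedFDerivWithin_add_apply (hf x hx) (hg x hx) hs hx]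
  exact norm_add_le _ _

theorem norm_iteratedFDerivWithin_sub_le {f g : E → F} {s : Set E} {i : ℕ} {x : E}
    (hf : ContDiffOn ℝ i f s) (hg : ContDiffOn ℝ i g s) (hs : UniqueDiffOn ℝ s) (hx : x ∈ s) :
    ‖iteratedFDerivWithin ℝ i (fun y => f y - g y) s x‖ ≤
      ‖iteratedFDerivWithin ℝ i f s x‖ + ‖iteratedFDerivWithin ℝ i g s x‖ := by
  rw [fun_iteratedFDerivWithin_sub_apply (hf x hx) (hg x hx) hs hx]
  exact norm_sub_le _ _

theorem norm_iteratedFDerivWithin_prodMk_le {f : E → F} {g : E → G} {s : Set E} {i : ℕ} {x : E}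
    (hf : ContDiffOn ℝ i f s) (hg : ContDiffOn ℝ i g s) (hs : UniqueDiffOn ℝ s) (hx : x ∈ s) :
    ‖iteratedFDerivWithin ℝ i (fun y => (f y, g y)) s x‖ ≤
      ‖iteratedFDerivWithin ℝ i f s x‖ + ‖iteratedFDerivWithin ℝ i g s x‖ := by
  rw [iteratedFDerivWithin_prodMk (hf x hx) (hg x hx) hs hx le_rfl,
    ContinuousMultilinearMap.opNorm_prod]
  exact max_le_add_of_nonneg (norm_nonneg _) (norm_nonneg _)

theorem norm_iteratedFDerivWithin_id_le {s : Set E} {i : ℕ} {x : E} (hi : 1 ≤ i)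
    (hs : UniqueDiffOn ℝ s) (hx : x ∈ s) :
    ‖iteratedFDerivWithin ℝ i (fun y : E => y) s x‖ ≤ 1 := by
  obtain ⟨i, rfl⟩ := Nat.exists_eq_add_of_le' hi
  have h : EqOn (fderivWithin ℝ (fun y : E => y) s) (fun _ => ContinuousLinearMap.id ℝ E) s :=
    fun y hy => fderivWithin_fun_id (hs y hy)
  rw [← norm_iteratedFDerivWithin_fderivWithin hs hx, iteratedFDerivWithin_congr h hx]
  rcases i with _ | i
  · simpa using ContinuousLinearMap.norm_id_le
  · simp [iteratedFDerivWithin_succ_const]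

/-- Leibniz bound for a composition of operator-valued maps, with the term carrying all the
derivatives on the second factor isolated. -/
theorem norm_iteratedFDerivWithin_clm_comp_le {H : Type u} [NormedAddCommGroup H]
    [NormedSpace ℝ H] {A : E → F →L[ℝ] G} {B : E → H →L[ℝ] F} {s : Set E} {j : ℕ} {x : E}
    (hA : ContDiffOn ℝ j A s) (hB : ContDiffOn ℝ j B s) (hs : UniqueDiffOn ℝ s) (hx : x ∈ s)
    {α β : ℝ} (hα : ∀ i, i ≤ j → ‖iteratedFDerivWithin ℝ i A s x‖ ≤ α)
    (hβ : ∀ i, i < j → ‖iteratedFDerivWithin ℝ i B s x‖ ≤ β) (hβ0 : 0 ≤ β) :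
    ‖iteratedFDerivWithin ℝ j (fun y => (A y).comp (B y)) s x‖ ≤
      ‖A x‖ * ‖iteratedFDerivWithin ℝ j B s x‖ + 2 ^ j * (α * β) := by
  have hα0 : 0 ≤ α := (norm_nonneg _).trans (hα 0 (Nat.zero_le _))
  refine ((ContinuousLinearMap.compL ℝ H F G).norm_iteratedFDerivWithin_le_of_bilinear_of_le_one
    hA hB hs hx le_rfl (ContinuousLinearMap.norm_compL_le ℝ H F G)).trans ?_
  rw [Finset.sum_range_succ', add_comm]
  refine add_le_add (by simp) ?_
  calc _ ≤ ∑ i ∈ Finset.range j, (j.choose (i + 1) : ℝ) * (α * β) := by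
        refine Finset.sum_le_sum fun i hi => ?_
        have hi := Finset.mem_range.1 hi
        rw [mul_assoc]
        gcongr
        · exact hα _ hi
        · exact hβ _ (by omega)
    _ ≤ 2 ^ j * (α * β) := by
        rw [← Finset.sum_mul]
        gcongr
        have := Nat.sum_range_choose j
        rw [Finset.sum_range_succ'] at this
        have h2 : ∑ i ∈ Finset.range j, j.choose (i + 1) ≤ 2 ^ j := by omega
        exact_mod_cast h2

theorem norm_iteratedFDerivWithin_comp_le_of_one_le {f : F → G} {ψ : E → F} {s : Set E}
    {t : Set F} {j : ℕ} {x : E} {b D : ℝ} (hf : ContDiffOn ℝ j f t) (hψ : ContDiffOn ℝ j ψ s)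
    (ht : UniqueDiffOn ℝ t) (hs : UniqueDiffOn ℝ s) (hst : MapsTo ψ s t) (hx : x ∈ s)
    (hb : ∀ i, i ≤ j → ∀ y ∈ t, ‖iteratedFDerivWithin ℝ i f t y‖ ≤ b) (hD1 : 1 ≤ D)
    (hD : ∀ i, 1 ≤ i → i ≤ j → ‖iteratedFDerivWithin ℝ i ψ s x‖ ≤ D) {i : ℕ} (hi : i ≤ j) :
    ‖iteratedFDerivWithin ℝ i (fun y => f (ψ y)) s x‖ ≤ j.factorial * b * D ^ j := by
  have hb0 : 0 ≤ b := (norm_nonneg _).trans (hb 0 (Nat.zero_le _) _ (hst hx))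
  refine (norm_iteratedFDerivWithin_comp_le hf hψ (by exact_mod_cast hi) ht hs hst hx
    (fun l hl => hb l (hl.trans hi) _ (hst hx)) (D := D) fun l hl hli =>
      (hD l hl (hli.trans hi)).trans (le_self_pow₀ hD1 (by omega))).trans ?_
  gcongr

theorem norm_sub_le_of_segment_subset {f : E → F} {t : Set E} {b : ℝ} {x v : E}
    (hf : DifferentiableOn ℝ f t) (hb : ∀ y ∈ t, ‖fderivWithin ℝ f t y‖ ≤ b)
    (hseg : segment ℝ x (x + v) ⊆ t) : ‖f (x + v) - f x‖ ≤ b * ‖v‖ := by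
  have := (convex_segment x (x + v)).norm_image_sub_le_of_norm_hasFDerivWithin_le
    (f := f) (f' := fderivWithin ℝ f t) (C := b)
    (fun y hy => (hf y (hseg hy)).hasFDerivWithinAt.mono hseg) (fun y hy => hb y (hseg hy))
    (left_mem_segment ℝ _ _) (right_mem_segment ℝ _ _)
  simpa using this

theorem fderivWithin_comp_add_self {f : E → F} {g : E → E} {s t : Set E} {x : E}
    (hf : DifferentiableOn ℝ f t) (hg : DifferentiableOn ℝ g s) (hs : UniqueDiffOn ℝ s)
    (hst : MapsTo (fun y => y + g y) s t) (hx : x ∈ s) :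
    fderivWithin ℝ (fun y => f (y + g y)) s x =
      fderivWithin ℝ f t (x + g x) +
        (fderivWithin ℝ f t (x + g x)).comp (fderivWithin ℝ g s x) := by
  have h1 : HasFDerivWithinAt (fun y => y + g y)
      (ContinuousLinearMap.id ℝ E + fderivWithin ℝ g s x) s x :=
    (hasFDerivWithinAt_id x s).add (hg x hx).hasFDerivWithinAt
  have h2 := ((hf _ (hst hx)).hasFDerivWithinAt.comp x h1 hst).fderivWithin (hs x hx)
  refine h2.trans ?_
  ext v
  simp

theorem norm_iteratedFDerivWithin_succ_comp_add_self_sub_le {f : E → F} {g : E → E} {s t : Set E}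
    {j : ℕ} {b e : ℝ} {q : E} (hs : IsOpen s) (ht : IsOpen t)
    (hf : ContDiffOn ℝ (j + 1 : ℕ) f t) (hg : ContDiffOn ℝ (j + 1 : ℕ) g s)
    (hst : MapsTo (fun y => y + g y) s t) (hsub : s ⊆ t)
    (hb : ∀ i, i ≤ j + 1 → ∀ y ∈ t, ‖iteratedFDerivWithin ℝ i f t y‖ ≤ b)
    (he : ∀ i, i ≤ j → ‖iteratedFDerivWithin ℝ i g s q‖ ≤ e) (hq : q ∈ s) :
    ‖iteratedFDerivWithin ℝ (j + 1) (fun y => f (y + g y) - f y) s q‖ ≤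
      ‖iteratedFDerivWithin ℝ j
          (fun y => fderivWithin ℝ f t (y + g y) - fderivWithin ℝ f t y) s q‖ +
        (‖fderivWithin ℝ f t (q + g q)‖ * ‖iteratedFDerivWithin ℝ (j + 1) g s q‖ +
          2 ^ j * (j.factorial * b * (1 + e) ^ j * e)) := by
  have hsu := hs.uniqueDiffOn (𝕜 := ℝ)
  have htu := ht.uniqueDiffOn (𝕜 := ℝ)
  have he0 : 0 ≤ e := (norm_nonneg _).trans (he 0 (by omega))
  have hfd : DifferentiableOn ℝ f t := hf.differentiableOn (by simp)
  have hgd : DifferentiableOn ℝ g s := hg.differentiableOn (by simp)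
  have hDf : ContDiffOn ℝ j (fderivWithin ℝ f t) t := hf.fderivWithin htu (by norm_cast)
  have hDg : ContDiffOn ℝ j (fderivWithin ℝ g s) s := hg.fderivWithin hsu (by norm_cast)
  have hgj : ContDiffOn ℝ j g s := hg.of_le (by norm_cast; omega)
  have hψ : ContDiffOn ℝ j (fun y => y + g y) s := contDiffOn_id.add hgj
  have hDfψ : ContDiffOn ℝ j (fun y => fderivWithin ℝ f t (y + g y)) s := hDf.comp hψ hst
  have heq : EqOn (fderivWithin ℝ (fun y => f (y + g y) - f y) s)
      (fun y => (fderivWithin ℝ f t (y + g y) - fderivWithin ℝ f t y) +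
        (fderivWithin ℝ f t (y + g y)).comp (fderivWithin ℝ g s y)) s := fun y hy => by
    have h1 : DifferentiableWithinAt ℝ (fun y => f (y + g y)) s y :=
      hfd.comp (differentiableOn_id.add hgd) hst y hy
    rw [fderivWithin_fun_sub (hsu y hy) h1 (hfd.mono hsub y hy),
      fderivWithin_comp_add_self hfd hgd hsu hst hy,
      fderivWithin_subset hsub (hsu y hy) (hfd y (hsub hy))]
    exact add_sub_right_comm _ _ _
  have hα : ∀ i, i ≤ j →
      ‖iteratedFDerivWithin ℝ i (fun y => fderivWithin ℝ f t (y + g y)) s q‖ ≤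
        j.factorial * b * (1 + e) ^ j := fun i hi =>
    norm_iteratedFDerivWithin_comp_le_of_one_le hDf hψ htu hsu hst hq
      (fun l hl y hy => by
        rw [norm_iteratedFDerivWithin_fderivWithin htu hy]
        exact hb _ (by omega) y hy)
      (by linarith)
      (fun l h1 hl => (norm_iteratedFDerivWithin_add_le contDiffOn_id
        (hg.of_le (by norm_cast; omega)) hsu hq).trans
          (add_le_add (norm_iteratedFDerivWithin_id_le h1 hsu hq) (he l hl))) hi
  rw [← norm_iteratedFDerivWithin_fderivWithin hsu hq, iteratedFDerivWithin_congr heq hq,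
    ← norm_iteratedFDerivWithin_fderivWithin (f := g) hsu hq]
  refine (norm_iteratedFDerivWithin_add_le (hDfψ.sub (hDf.mono hsub))
    (hDfψ.clm_comp hDg) hsu hq).trans (add_le_add le_rfl ?_)
  exact norm_iteratedFDerivWithin_clm_comp_le hDfψ hDg hsu hq hα
    (fun i hi => by
      rw [norm_iteratedFDerivWithin_fderivWithin hsu hq]
      exact he _ (by omega)) he0

/-- The map `q ↦ f (q + g q) - f q` has derivatives controlled linearly by those of `g`. -/
theorem exists_norm_iteratedFDerivWithin_comp_add_self_sub_le (j : ℕ) :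
    ∃ c : ℕ, ∀ {E F : Type u} [NormedAddCommGroup E] [NormedSpace ℝ E]
      [NormedAddCommGroup F] [NormedSpace ℝ F] {f : E → F} {g : E → E} {s t : Set E} {b e : ℝ},
      IsOpen s → IsOpen t → ContDiffOn ℝ (j + 1 : ℕ) f t → ContDiffOn ℝ j g s →
      (∀ q ∈ s, segment ℝ q (q + g q) ⊆ t) →
      (∀ i, i ≤ j + 1 → ∀ y ∈ t, ‖iteratedFDerivWithin ℝ i f t y‖ ≤ b) →
      (∀ i, i ≤ j → ∀ q ∈ s, ‖iteratedFDerivWithin ℝ i g s q‖ ≤ e) →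
      ∀ q ∈ s, ‖iteratedFDerivWithin ℝ j (fun y => f (y + g y) - f y) s q‖ ≤
        c * b * (1 + e) ^ j * e := by
  induction j with
  | zero =>
    refine ⟨1, ?_⟩
    intro E F _ _ _ _ f g s t b e hs ht hf hg hseg hb he q hq
    have hb' : ∀ y ∈ t, ‖fderivWithin ℝ f t y‖ ≤ b := fun y hy => by
      rw [← norm_iteratedFDerivWithin_one f (ht.uniqueDiffOn y hy)]
      exact hb 1 le_rfl y hy
    have h := norm_sub_le_of_segment_subset (hf.differentiableOn (by simp)) hb' (hseg q hq)
    have hq' := hseg q hq (left_mem_segment ℝ _ _)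
    have hb0 : 0 ≤ b := (norm_nonneg _).trans (hb' q hq')
    have he0 := he 0 le_rfl q hq
    simp only [norm_iteratedFDerivWithin_zero] at he0 ⊢
    simpa using h.trans (mul_le_mul_of_nonneg_left he0 hb0)
  | succ j ih =>
    obtain ⟨c, hc⟩ := ih
    refine ⟨c + 1 + 2 ^ j * j.factorial, ?_⟩
    intro E F _ _ _ _ f g s t b e hs ht hf hg hseg hb he q hq
    have htu := ht.uniqueDiffOn (𝕜 := ℝ)
    have hsub : s ⊆ t := fun y hy => hseg y hy (left_mem_segment ℝ _ _)
    have hb0 : 0 ≤ b := (norm_nonneg _).trans (hb 0 (by omega) q (hsub hq))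
    have he0 : 0 ≤ e := (norm_nonneg _).trans (he 0 (by omega) q hq)
    have hst : MapsTo (fun y => y + g y) s t := fun y hy => hseg y hy (right_mem_segment ℝ _ _)
    have hDf : ContDiffOn ℝ (j + 1 : ℕ) (fderivWithin ℝ f t) t :=
      hf.fderivWithin htu (by norm_cast)
    have hfirst := hc hs ht hDf (hg.of_le (by norm_cast; omega)) hseg
      (fun i hi y hy => by
        rw [norm_iteratedFDerivWithin_fderivWithin htu hy]
        exact hb _ (by omega) y hy)
      (fun i hi => he i (by omega)) q hq
    have hDfq : ‖fderivWithin ℝ f t (q + g q)‖ ≤ b := by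
      rw [← norm_iteratedFDerivWithin_one f (htu _ (hst hq))]
      exact hb 1 (by omega) _ (hst hq)
    refine (norm_iteratedFDerivWithin_succ_comp_add_self_sub_le hs ht
      (hf.of_le (by norm_cast; omega)) hg hst hsub (fun i hi => hb i (by omega))
      (fun i hi => he i (by omega) q hq) hq).trans ?_
    have hp : (1 + e) ^ j ≤ (1 + e) ^ (j + 1) := pow_le_pow_right₀ (by linarith) (by omega)
    have h1 : 1 ≤ (1 + e) ^ (j + 1) := one_le_pow₀ (by linarith)
    calc _ ≤ c * b * (1 + e) ^ (j + 1) * e +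
          (b * 1 * e + 2 ^ j * (j.factorial * b * (1 + e) ^ (j + 1) * e)) := by
          rw [mul_one]
          refine add_le_add (hfirst.trans ?_) (add_le_add ?_ ?_)
          · gcongr
          · gcongr
            exact he _ le_rfl q hq
          · gcongr
      _ ≤ c * b * (1 + e) ^ (j + 1) * e +
          (b * (1 + e) ^ (j + 1) * e + 2 ^ j * (j.factorial * b * (1 + e) ^ (j + 1) * e)) := by
          gcongr
      _ = _ := by
          push_cast
          ring

theorem norm_iteratedFDerivWithin_succ_comp_graph_le {X : Type u} [NormedAddCommGroup X]
    [NormedSpace ℝ X] {g : X × E → F} {φ : E → X} {s : Set E} {U : Set (X × E)} {j : ℕ}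
    {D ε : ℝ} {q : E} (hs : IsOpen s) (hU : IsOpen U)
    (hg : ContDiffOn ℝ (j + 1 : ℕ) g U) (hφ : ContDiffOn ℝ (j + 1 : ℕ) φ s)
    (hmaps : MapsTo (fun y => (φ y, y)) s U)
    (hε : ∀ i, i ≤ j + 1 → ∀ z ∈ U, ‖iteratedFDerivWithin ℝ i g U z‖ ≤ ε) (hD1 : 1 ≤ D)
    (hD : ∀ i, 1 ≤ i → i ≤ j → ‖iteratedFDerivWithin ℝ i (fun y => (φ y, y)) s q‖ ≤ D)
    (hq : q ∈ s) :
    ‖iteratedFDerivWithin ℝ (j + 1) (fun y => g (φ y, y)) s q‖ ≤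
      ‖fderivWithin ℝ g U (φ q, q)‖ * (‖iteratedFDerivWithin ℝ (j + 1) φ s q‖ + 1) +
        2 ^ j * (j.factorial * ε * D ^ j * D) := by
  have hsu := hs.uniqueDiffOn (𝕜 := ℝ)
  have hUu := hU.uniqueDiffOn (𝕜 := ℝ)
  have hΦ : ContDiffOn ℝ (j + 1 : ℕ) (fun y => (φ y, y)) s := hφ.prodMk contDiffOn_id
  have hΦj : ContDiffOn ℝ j (fun y => (φ y, y)) s := hΦ.of_le (by norm_cast; omega)
  have hDg : ContDiffOn ℝ j (fderivWithin ℝ g U) U := hg.fderivWithin hUu (by norm_cast)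
  have hDΦ : ContDiffOn ℝ j (fderivWithin ℝ (fun y => (φ y, y)) s) s :=
    hΦ.fderivWithin hsu (by norm_cast)
  have heq : EqOn (fderivWithin ℝ (fun y => g (φ y, y)) s)
      (fun y => (fderivWithin ℝ g U (φ y, y)).comp (fderivWithin ℝ (fun y => (φ y, y)) s y)) s :=
    fun y hy => fderivWithin_comp y (hg.differentiableOn (by simp) _ (hmaps hy))
      (hΦ.differentiableOn (by simp) y hy) hmaps (hsu y hy)
  have hα : ∀ i, i ≤ j →
      ‖iteratedFDerivWithin ℝ i (fun y => fderivWithin ℝ g U (φ y, y)) s q‖ ≤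
        j.factorial * ε * D ^ j := fun i hi =>
    norm_iteratedFDerivWithin_comp_le_of_one_le hDg hΦj hUu hsu hmaps hq
      (fun l hl z hz => by
        rw [norm_iteratedFDerivWithin_fderivWithin hUu hz]
        exact hε _ (by omega) z hz) hD1 hD hi
  rw [← norm_iteratedFDerivWithin_fderivWithin hsu hq, iteratedFDerivWithin_congr heq hq]
  refine (norm_iteratedFDerivWithin_clm_comp_le
    (A := fun y => fderivWithin ℝ g U (φ y, y)) (hDg.comp hΦj hmaps) hDΦ hsu hq hα
    (fun i hi => by
      rw [norm_iteratedFDerivWithin_fderivWithin hsu hq]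
      exact hD _ (by omega) (by omega)) (by linarith)).trans ?_
  gcongr
  rw [norm_iteratedFDerivWithin_fderivWithin hsu hq]
  exact (norm_iteratedFDerivWithin_prodMk_le hφ contDiffOn_id hsu hq).trans
    (add_le_add le_rfl (norm_iteratedFDerivWithin_id_le (by omega) hsu hq))

theorem norm_iteratedFDerivWithin_fst_le {f : E → F × G} {s : Set E} {i : ℕ} {x : E}
    (hf : ContDiffOn ℝ i f s) (hs : UniqueDiffOn ℝ s) (hx : x ∈ s) :
    ‖iteratedFDerivWithin ℝ i (fun y => (f y).1) s x‖ ≤ ‖iteratedFDerivWithin ℝ i f s x‖ :=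
  ((ContinuousLinearMap.fst ℝ F G).norm_iteratedFDerivWithin_comp_left (hf x hx) hs hx
    le_rfl).trans (mul_le_of_le_one_left (norm_nonneg _) (ContinuousLinearMap.norm_fst_le ..))

theorem norm_iteratedFDerivWithin_snd_le {f : E → F × G} {s : Set E} {i : ℕ} {x : E}
    (hf : ContDiffOn ℝ i f s) (hs : UniqueDiffOn ℝ s) (hx : x ∈ s) :
    ‖iteratedFDerivWithin ℝ i (fun y => (f y).2) s x‖ ≤ ‖iteratedFDerivWithin ℝ i f s x‖ :=
  ((ContinuousLinearMap.snd ℝ F G).norm_iteratedFDerivWithin_comp_left (hf x hx) hs hx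
    le_rfl).trans (mul_le_of_le_one_left (norm_nonneg _) (ContinuousLinearMap.norm_snd_le ..))

theorem aeval_nat_nonneg (P : Polynomial ℕ) {M : ℝ} (hM : 0 ≤ M) :
    0 ≤ Polynomial.aeval M P := by
  rw [Polynomial.aeval_eq_sum_range]
  exact Finset.sum_nonneg fun i _ => by positivity

theorem aeval_nat_le (P : Polynomial ℕ) {M : ℝ} (hM : 1 ≤ M) :
    Polynomial.aeval M P ≤ (P.eval 1 : ℕ) * M ^ P.natDegree := by
  rw [Polynomial.aeval_eq_sum_range, Polynomial.eval_eq_sum_range]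
  push_cast
  rw [Finset.sum_mul]
  refine Finset.sum_le_sum fun i hi => ?_
  simp only [nsmul_eq_mul, one_pow, mul_one]
  gcongr
  exact Nat.lt_succ_iff.1 (Finset.mem_range.1 hi)

/-- A map `φ` solving `φ + g₁(φ, ·) = φ0 (id + g₂(φ, ·))` differs from `φ0`, to each order, by at
most the size of `g` times a universal polynomial in the size of `φ0`. -/
theorem exists_polynomial_bound_graph_sub (j : ℕ) :
    ∃ P : Polynomial ℕ, ∀ {E X : Type u} [NormedAddCommGroup E] [NormedSpace ℝ E]
      [NormedAddCommGroup X] [NormedSpace ℝ X] {s t : Set E} {U : Set (X × E)} {φ0 φ : E → X}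
      {g : X × E → X × E} {M ε η : ℝ},
      IsOpen s → IsOpen t → IsOpen U → ContDiffOn ℝ (j + 1 : ℕ) φ0 t → ContDiffOn ℝ j φ s →
      ContDiffOn ℝ j g U → MapsTo (fun y => (φ y, y)) s U →
      (∀ q ∈ s, segment ℝ q (q + (g (φ q, q)).2) ⊆ t) →
      (∀ q ∈ s, φ q + (g (φ q, q)).1 = φ0 (q + (g (φ q, q)).2)) → 1 ≤ M →
      (∀ i, i ≤ j + 1 → ∀ y ∈ t, ‖iteratedFDerivWithin ℝ i φ0 t y‖ ≤ M) →
      (∀ i, i ≤ j → ∀ z ∈ U, ‖iteratedFDerivWithin ℝ i g U z‖ ≤ ε) → ε ≤ 1 →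
      (∀ z ∈ U, ‖fderivWithin ℝ g U z‖ ≤ η) →
      (∀ q ∈ s, (1 + ‖fderivWithin ℝ φ0 t (q + (g (φ q, q)).2)‖) * η ≤ 1 / 2) →
      ∀ i, i ≤ j → ∀ q ∈ s, ‖iteratedFDerivWithin ℝ i (fun y => φ y - φ0 y) s q‖ ≤
        Polynomial.aeval M P * ε := by
  induction j with
  | zero =>
    refine ⟨Polynomial.X + 1, ?_⟩
    intro E X _ _ _ _ s t U φ0 φ g M ε η hs ht hU hφ0 hφ hg hmaps hseg heq hM hM0 hε hε1 hη hη2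
      i hi q hq
    obtain rfl : i = 0 := by omega
    have htu := ht.uniqueDiffOn (𝕜 := ℝ)
    have h := norm_sub_le_of_segment_subset (hφ0.differentiableOn (by simp))
      (fun y hy => (norm_iteratedFDerivWithin_one φ0 (htu y hy)).ge.trans (hM0 1 le_rfl y hy))
      (hseg q hq)
    have hgε := hε 0 le_rfl _ (hmaps hq)
    simp only [norm_iteratedFDerivWithin_zero] at hgε ⊢
    have h1 := (norm_fst_le (g (φ q, q))).trans hgε
    have h2 := (norm_snd_le (g (φ q, q))).trans hgε
    have h3 : φ q - φ0 q = (φ0 (q + (g (φ q, q)).2) - φ0 q) - (g (φ q, q)).1 := by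
      rw [← heq q hq]
      abel
    rw [h3]
    simp only [map_add, Polynomial.aeval_X, map_one]
    calc _ ≤ M * ε + ε := (norm_sub_le _ _).trans (add_le_add (h.trans (by gcongr)) h1)
      _ = _ := by ring
  | succ j ih =>
    obtain ⟨P, hP⟩ := ih
    obtain ⟨c, hc⟩ := exists_norm_iteratedFDerivWithin_comp_add_self_sub_le.{u} j
    let D' : Polynomial ℕ := Polynomial.X + P + 1
    let K' : Polynomial ℕ := (j.factorial : Polynomial ℕ) * D' ^ j
    let B' : Polynomial ℕ := Polynomial.X + 1 + 2 ^ j * (K' * D')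
    let Q' : Polynomial ℕ := (1 + Polynomial.X) * B' +
      ((c : Polynomial ℕ) + 2 ^ j * (j.factorial : Polynomial ℕ)) * Polynomial.X * (1 + K') ^ j * K'
    refine ⟨P + 2 * Q', ?_⟩
    intro E X _ _ _ _ s t U φ0 φ g M ε η hs ht hU hφ0 hφ hg hmaps hseg heq hM hM0 hε hε1 hη hη2
      i hi q hq
    have hsu := hs.uniqueDiffOn (𝕜 := ℝ)
    have htu := ht.uniqueDiffOn (𝕜 := ℝ)
    have hUu := hU.uniqueDiffOn (𝕜 := ℝ)
    have hst : MapsTo (fun y => y + (g (φ y, y)).2) s t :=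
      fun y hy => hseg y hy (right_mem_segment ℝ _ _)
    have hsub : s ⊆ t := fun y hy => hseg y hy (left_mem_segment ℝ _ _)
    have hε0 : 0 ≤ ε := (norm_nonneg _).trans (hε 0 (by omega) _ (hmaps hq))
    have hM1 : 0 ≤ M := by linarith
    set p := Polynomial.aeval M P with hp
    set D := Polynomial.aeval M D' with hD
    set K := Polynomial.aeval M K' with hK
    set B := Polynomial.aeval M B' with hB
    set Q := Polynomial.aeval M Q' with hQ
    have hp0 : 0 ≤ p := aeval_nat_nonneg P hM1
    have hK0 : 0 ≤ K := aeval_nat_nonneg K' hM1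
    have hQ0 : 0 ≤ Q := aeval_nat_nonneg Q' hM1
    have hB0 : 0 ≤ B := aeval_nat_nonneg B' hM1
    have hDe : D = M + p + 1 := by simp [hD, D', hp]
    have hKe : K = j.factorial * D ^ j := by simp [hK, K', hD]
    have h2e : Polynomial.aeval M (2 : Polynomial ℕ) = 2 := map_ofNat _ 2
    have hBe : B = M + 1 + 2 ^ j * (K * D) := by simp [hB, B', hK, hD, h2e]
    have hQe : Q = (1 + M) * B + (c + 2 ^ j * j.factorial) * M * (1 + K) ^ j * K := by
      simp [hQ, Q', hB, hK, h2e]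
    have hgoal : Polynomial.aeval M (P + 2 * Q') = p + 2 * Q := by simp [hp, hQ, h2e]
    rw [hgoal]
    have hlow : ∀ i, i ≤ j → ∀ q ∈ s,
        ‖iteratedFDerivWithin ℝ i (fun y => φ y - φ0 y) s q‖ ≤ p * ε :=
      hP hs ht hU (hφ0.of_le (by norm_cast; omega)) (hφ.of_le (by norm_cast; omega))
        (hg.of_le (by norm_cast; omega)) hmaps hseg heq hM (fun i hi => hM0 i (by omega))
        (fun i hi => hε i (by omega)) hε1 hη hη2
    rcases Nat.lt_or_eq_of_le hi with hi | rfl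
    · exact (hlow i (by omega) q hq).trans (by gcongr; linarith)
    have hφ0s : ContDiffOn ℝ (j + 1 : ℕ) φ0 s := (hφ0.of_le (by norm_cast; omega)).mono hsub
    have hM0s : ∀ i, i ≤ j + 1 → ∀ y ∈ s, ‖iteratedFDerivWithin ℝ i φ0 s y‖ ≤ M :=
      fun i hi y hy => by
        rw [iteratedFDerivWithin_subset hsub hsu htu (hφ0.of_le (by norm_cast; omega)) hy]
        exact hM0 i (by omega) y (hsub hy)
    have hφle : ∀ i, i ≤ j + 1 → ∀ y ∈ s, ‖iteratedFDerivWithin ℝ i φ s y‖ ≤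
        ‖iteratedFDerivWithin ℝ i (fun y => φ y - φ0 y) s y‖ + M := fun i hi y hy => by
      have h := norm_iteratedFDerivWithin_add_le (i := i) (f := fun y => φ y - φ0 y) (g := φ0)
        ((hφ.sub hφ0s).of_le (by norm_cast)) (hφ0s.of_le (by norm_cast)) hsu hy
      simp only [sub_add_cancel] at h
      exact h.trans (add_le_add le_rfl (hM0s i hi y hy))
    have hD1 : 1 ≤ D := by linarith
    have hΦD : ∀ i, 1 ≤ i → i ≤ j → ∀ y ∈ s,
        ‖iteratedFDerivWithin ℝ i (fun y => (φ y, y)) s y‖ ≤ D := fun i h1 hi y hy => by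
      have h := norm_iteratedFDerivWithin_prodMk_le (i := i) (f := φ) (g := fun y => y)
        (hφ.of_le (by norm_cast; omega)) contDiffOn_id hsu hy
      have h2 := norm_iteratedFDerivWithin_id_le h1 hsu hy
      have h3 := hφle i (by omega) y hy
      have h4 := hlow i hi y hy
      have h5 : p * ε ≤ p := mul_le_of_le_one_right hp0 hε1
      linarith
    have hΦ : ContDiffOn ℝ (j + 1 : ℕ) (fun y => (φ y, y)) s := hφ.prodMk contDiffOn_id
    have hG : ContDiffOn ℝ (j + 1 : ℕ) (fun y => g (φ y, y)) s := hg.comp hΦ hmaps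
    have hGlow : ∀ i, i ≤ j → ∀ y ∈ s,
        ‖iteratedFDerivWithin ℝ i (fun y => g (φ y, y)) s y‖ ≤ K * ε := fun i hi y hy => by
      refine (norm_iteratedFDerivWithin_comp_le_of_one_le (j := j) (hg.of_le (by norm_cast; omega))
        (hΦ.of_le (by norm_cast; omega)) hUu hsu hmaps hy (fun l hl => hε l (by omega)) hD1
        (fun l h1 hl => hΦD l h1 hl y hy) hi).trans_eq ?_
      rw [hKe]
      ring
    set a := ‖iteratedFDerivWithin ℝ (j + 1) (fun y => φ y - φ0 y) s q‖ with ha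
    have ha0 : 0 ≤ a := norm_nonneg _
    set ℓ := ‖fderivWithin ℝ φ0 t (q + (g (φ q, q)).2)‖ with hℓ
    have hℓ0 : 0 ≤ ℓ := norm_nonneg _
    have hℓM : ℓ ≤ M := by
      rw [hℓ, ← norm_iteratedFDerivWithin_one φ0 (htu _ (hst hq))]
      exact hM0 1 (by omega) _ (hst hq)
    have hGtop : ‖iteratedFDerivWithin ℝ (j + 1) (fun y => g (φ y, y)) s q‖ ≤
        η * a + B * ε := by
      have h := norm_iteratedFDerivWithin_succ_comp_graph_le hs hU hg hφ hmaps hε hD1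
        (fun l h1 hl => hΦD l h1 hl q hq) hq
      have h1 : ‖fderivWithin ℝ g U (φ q, q)‖ ≤ ε := by
        rw [← norm_iteratedFDerivWithin_one g (hUu _ (hmaps hq))]
        exact hε 1 (by omega) _ (hmaps hq)
      have h2 := hφle (j + 1) le_rfl q hq
      calc _ ≤ ‖fderivWithin ℝ g U (φ q, q)‖ * (a + M + 1) + 2 ^ j * (j.factorial * ε * D ^ j * D) :=
            h.trans (by gcongr)
        _ = ‖fderivWithin ℝ g U (φ q, q)‖ * a + ‖fderivWithin ℝ g U (φ q, q)‖ * (M + 1) +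
              2 ^ j * (j.factorial * ε * D ^ j * D) := by ring
        _ ≤ η * a + ε * (M + 1) + 2 ^ j * (j.factorial * ε * D ^ j * D) := by
            gcongr
            exact hη _ (hmaps hq)
        _ = _ := by
            rw [hBe, hKe]
            ring
    have hG2 : ContDiffOn ℝ (j + 1 : ℕ) (fun y => (g (φ y, y)).2) s := hG.snd
    have hG2low : ∀ i, i ≤ j → ∀ y ∈ s,
        ‖iteratedFDerivWithin ℝ i (fun y => (g (φ y, y)).2) s y‖ ≤ K * ε := fun i hi y hy =>
      (norm_iteratedFDerivWithin_snd_le (hG.of_le (by norm_cast; omega)) hsu hy).trans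
        (hGlow i hi y hy)
    have hdiff := hc hs ht (hφ0.fderivWithin (m := (j + 1 : ℕ)) htu (by norm_cast))
      (hG2.of_le (by norm_cast; omega)) hseg
      (fun i hi y hy => by
        rw [norm_iteratedFDerivWithin_fderivWithin htu hy]
        exact hM0 _ (by omega) y hy) hG2low q hq
    have hstep := norm_iteratedFDerivWithin_succ_comp_add_self_sub_le hs ht
      (hφ0.of_le (by norm_cast; omega)) hG2 hst hsub (fun i hi => hM0 i (by omega))
      (fun i hi => hG2low i hi q hq) hq
    have hheq : EqOn (fun y => φ y - φ0 y)
        (fun y => (φ0 (y + (g (φ y, y)).2) - φ0 y) - (g (φ y, y)).1) s := fun y hy => by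
      simp only [← heq y hy]
      abel
    have hφ0ψ : ContDiffOn ℝ (j + 1 : ℕ) (fun y => φ0 (y + (g (φ y, y)).2)) s :=
      ContDiffOn.comp (g := φ0) (hφ0.of_le (by norm_cast; omega)) (contDiffOn_id.add hG2) hst
    have hsplit : a ≤ ‖iteratedFDerivWithin ℝ (j + 1)
          (fun y => φ0 (y + (g (φ y, y)).2) - φ0 y) s q‖ +
        ‖iteratedFDerivWithin ℝ (j + 1) (fun y => (g (φ y, y)).1) s q‖ := by
      rw [ha, iteratedFDerivWithin_congr hheq hq]
      exact norm_iteratedFDerivWithin_sub_le (hφ0ψ.sub hφ0s) hG.fst hsu hq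
    have hG1top := (norm_iteratedFDerivWithin_fst_le hG hsu hq).trans hGtop
    have hG2top := (norm_iteratedFDerivWithin_snd_le hG hsu hq).trans hGtop
    have hKε : K * ε ≤ K := mul_le_of_le_one_right hK0 hε1
    have hmain : a ≤ (1 + ℓ) * η * a + Q * ε := by
      calc a ≤ (c * M * (1 + K) ^ j * (K * ε) +
            (ℓ * (η * a + B * ε) + 2 ^ j * (j.factorial * M * (1 + K) ^ j * (K * ε)))) +
            (η * a + B * ε) := by
            refine hsplit.trans (add_le_add (hstep.trans (add_le_add (hdiff.trans ?_)
              (add_le_add ?_ ?_))) hG1top) <;> gcongr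
        _ = (1 + ℓ) * η * a + ((1 + ℓ) * B + (c + 2 ^ j * j.factorial) * M * (1 + K) ^ j * K) * ε := by
            ring
        _ ≤ _ := by
            rw [hQe]
            gcongr
    have habs : (1 + ℓ) * η * a ≤ 1 / 2 * a := mul_le_mul_of_nonneg_right (hη2 q hq) ha0
    have := mul_nonneg hp0 hε0
    linarith

theorem norm_le_toReal_CnormOn {u : E → F} {S : Set E} {k : ℕ} (h : CnormOn u S k ≠ ⊤) :
    ∀ i, i ≤ k → ∀ x ∈ S, ‖iteratedFDerivWithin ℝ i u S x‖ ≤ (CnormOn u S k).toReal :=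
  fun i hi x hx => by
    refine (ENNReal.ofReal_le_iff_le_toReal h).1 ?_
    exact le_iSup_of_le (⟨i, by omega⟩ : Fin (k + 1)) (le_iSup₂_of_le x hx le_rfl)

theorem CnormOn_le_ofReal {u : E → F} {S : Set E} {k : ℕ} {r : ℝ}
    (h : ∀ i, i ≤ k → ∀ x ∈ S, ‖iteratedFDerivWithin ℝ i u S x‖ ≤ r) :
    CnormOn u S k ≤ ENNReal.ofReal r :=
  iSup_le fun i => iSup₂_le fun x hx => ENNReal.ofReal_le_ofReal (h i (by omega) x hx)

theorem CnormOn_mono {u : E → F} {S : Set E} {k p : ℕ} (h : k ≤ p) :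
    CnormOn u S k ≤ CnormOn u S p :=
  iSup_le fun i => le_iSup_of_le (⟨i, by omega⟩ : Fin (p + 1)) le_rfl

theorem CnormOn_eq_zero_of_eqOn {u : E → F} {S : Set E} {k : ℕ} (h : ∀ x ∈ S, u x = 0) :
    CnormOn u S k = 0 := by
  rw [← nonpos_iff_eq_zero, ← ENNReal.ofReal_zero]
  refine CnormOn_le_ofReal fun i _ x hx => ?_
  rw [iteratedFDerivWithin_congr (f := fun _ => 0) h hx, iteratedFDerivWithin_fun_zero]
  simp

/-- A bounded set whose closure lies in an open set `t` has a neighbourhood of fixed width on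
which a `C¹` function on `t` has bounded derivative. -/
theorem exists_ball_subset_and_norm_fderivWithin_le [ProperSpace E] {f : E → F} {s t : Set E}
    (hs : Bornology.IsBounded s) (ht : IsOpen t) (hst : closure s ⊆ t) (hf : ContDiffOn ℝ 1 f t) :
    ∃ r > 0, ∃ L, ∀ q ∈ s, ∀ v, ‖v‖ ≤ r →
      segment ℝ q (q + v) ⊆ t ∧ ‖fderivWithin ℝ f t (q + v)‖ ≤ L := by
  obtain ⟨r, hr, hrt⟩ := hs.isCompact_closure.exists_cthickening_subset_open ht hst
  obtain ⟨L, hL⟩ := (hs.isCompact_closure.cthickening (r := r)).exists_bound_of_continuousOn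
    ((hf.continuousOn_fderivWithin ht.uniqueDiffOn le_rfl).mono hrt)
  have hball : ∀ q ∈ s, Metric.closedBall q r ⊆ Metric.cthickening r (closure s) := fun q hq =>
    Metric.closedBall_subset_cthickening (subset_closure hq) r
  have hmem : ∀ (q v : E), ‖v‖ ≤ r → q + v ∈ Metric.closedBall q r := fun q v hv => by
    simpa [Metric.mem_closedBall, dist_eq_norm] using hv
  exact ⟨r, hr, L, fun q hq v hv =>
    ⟨((convex_closedBall q r).segment_subset (Metric.mem_closedBall_self hr.le)
      (hmem q v hv)).trans ((hball q hq).trans hrt), hL _ (hball q hq (hmem q v hv))⟩⟩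

end Auxiliary

/-- **Comparison of the graphing functions of a perturbed CR manifold.**
Points of `ℂⁿ` are written `z = (X + iY, W)`, modelled as `(X, (Y, W))` with
`X, Y ∈ ℝᵐ`, `W ∈ ℂ^{n-m}`.  `M₀` is the graph `X = φ⁽⁰⁾(Y,W)` over `V'`, with defining
functions `ρ⁽⁰⁾_l(z) = X_l - φ⁽⁰⁾_l(Y,W)`, and `ρ_l(z) = ρ⁽⁰⁾_l(z + g z)`.  There are
constants `C k > 0` and exponents `N k` depending only on `n, m, k`, and a `δ > 0`
(possibly depending on everything else), such that whenever `|g|_{C^p(𝒰)} < δ` and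
`φ : V → ℝᵐ` is a `C^p` map whose graph lies in `𝒰` and satisfies
`ρ_l(φ(Y,W) + iY, W) = 0`, then for every `k ≤ p - 1`
`|φ - φ⁽⁰⁾|_{C^k(V)} ≤ C k · (1 + |φ⁽⁰⁾|_{C^{k+1}(V')})^{N k} · |g|_{C^k(𝒰)}`. -/
theorem graphing_function_comparison (n m p : ℕ) (hm : 1 ≤ m) (hmn : m < n) :
    ∃ C : ℕ → ℝ, ∃ N : ℕ → ℕ, (∀ k, 0 < C k) ∧
    ∀ (V V' : Set ((Fin m → ℝ) × (Fin (n - m) → ℂ))),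
      IsOpen V → Bornology.IsBounded V → IsOpen V' → closure V ⊆ V' →
    ∀ φ0 : (Fin m → ℝ) × (Fin (n - m) → ℂ) → Fin m → ℝ,
      ContDiffOn ℝ p φ0 V' →
    ∀ 𝒰 : Set ((Fin m → ℝ) × ((Fin m → ℝ) × (Fin (n - m) → ℂ))),
      IsOpen 𝒰 → Bornology.IsBounded 𝒰 →
      -- `𝒰` contains the graph `M₀` of `φ⁽⁰⁾` over `V'`
      (∀ q ∈ V', (φ0 q, q) ∈ 𝒰) →
      ∃ δ > (0 : ℝ),
        ∀ g : (Fin m → ℝ) × ((Fin m → ℝ) × (Fin (n - m) → ℂ)) →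
              (Fin m → ℝ) × ((Fin m → ℝ) × (Fin (n - m) → ℂ)),
          ContDiffOn ℝ p g 𝒰 →
          -- `z + g z ∈ Ω = ℝᵐ × V'` for all `z ∈ 𝒰`
          (∀ z ∈ 𝒰, (z + g z).2 ∈ V') →
          CnormOn g 𝒰 p < ENNReal.ofReal δ →
          ∀ φ : (Fin m → ℝ) × (Fin (n - m) → ℂ) → Fin m → ℝ,
            ContDiffOn ℝ p φ V →
            -- the graph of `φ` over `V` lies in `𝒰` and `ρ_l` vanishes on it,
            -- i.e. `ρ⁽⁰⁾(z + g z) = 0` at `z = (φ q, q)`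
            (∀ q ∈ V, (φ q, q) ∈ 𝒰 ∧
              ((φ q, q) + g (φ q, q)).1 = φ0 (((φ q, q) + g (φ q, q)).2)) →
            ∀ k : ℕ, k + 1 ≤ p →
              CnormOn (fun q => φ q - φ0 q) V k ≤
                ENNReal.ofReal (C k) * (1 + CnormOn φ0 V' (k + 1)) ^ (N k) *
                  CnormOn g 𝒰 k := by
  choose P hP using exists_polynomial_bound_graph_sub.{0}
  refine ⟨fun k => (P k).eval 1 + 1, fun k => (P k).natDegree + 1,
    fun k => by positivity, ?_⟩
  intro V V' hV hVb hV' hVV' φ0 hφ0 U hU hUb hgraph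
  rcases Nat.eq_zero_or_pos p with rfl | hp
  · exact ⟨1, one_pos, fun _ _ _ _ _ _ _ k hk => absurd hk (by omega)⟩
  obtain ⟨r, hr, L, hL⟩ := exists_ball_subset_and_norm_fderivWithin_le hVb hV' hVV'
    (hφ0.of_le (by exact_mod_cast hp))
  refine ⟨min (min 1 r) (1 / (2 * (1 + |L|))), by positivity, ?_⟩
  intro g hg _ hgδ φ hφ hφU k hk
  set δ := min (min 1 r) (1 / (2 * (1 + |L|))) with hδ
  have hδ0 : 0 ≤ δ := by positivity
  have hδ1 : δ ≤ 1 := (min_le_left _ _).trans (min_le_left _ _)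
  have hδr : δ ≤ r := (min_le_left _ _).trans (min_le_right _ _)
  have hδL : (1 + |L|) * δ ≤ 1 / 2 := by
    have h : δ ≤ 1 / (2 * (1 + |L|)) := min_le_right _ _
    rw [le_div_iff₀ (by positivity)] at h
    linarith
  have hgp_top : CnormOn g U p ≠ ⊤ := hgδ.ne_top
  have hgp := norm_le_toReal_CnormOn hgp_top
  have hgpδ : (CnormOn g U p).toReal ≤ δ := ENNReal.toReal_le_of_le_ofReal hδ0 hgδ.le
  have hgk_top : CnormOn g U k ≠ ⊤ := ne_top_of_le_ne_top hgp_top (CnormOn_mono (by omega))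
  have hgk := norm_le_toReal_CnormOn hgk_top
  have hgkp : (CnormOn g U k).toReal ≤ (CnormOn g U p).toReal :=
    ENNReal.toReal_mono hgp_top (CnormOn_mono (by omega))
  have hgδ0 : ∀ z ∈ U, ‖g z‖ ≤ δ := fun z hz => by
    simpa using (hgp 0 (by omega) z hz).trans hgpδ
  by_cases hg0 : CnormOn g U k = 0
  · rw [CnormOn_eq_zero_of_eqOn]
    · exact zero_le
    · intro q hq
      obtain ⟨h1, h2⟩ := hφU q hq
      have h3 : g (φ q, q) = 0 := by
        simpa [hg0] using hgk 0 (by omega) _ h1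
      rw [h3] at h2
      simpa [sub_eq_zero] using h2
  by_cases hφ0_top : CnormOn φ0 V' (k + 1) = ⊤
  · rw [hφ0_top, add_top, ENNReal.top_pow (Nat.succ_ne_zero _), ENNReal.mul_top, ENNReal.top_mul hg0]
    · exact le_top
    · exact (ENNReal.ofReal_pos.2 (by positivity)).ne'
  have hM := norm_le_toReal_CnormOn hφ0_top
  set M := 1 + (CnormOn φ0 V' (k + 1)).toReal with hMdef
  have hM1 : 1 ≤ M := le_add_of_nonneg_right ENNReal.toReal_nonneg
  have hsmall : ∀ q ∈ V, ‖(g (φ q, q)).2‖ ≤ r := fun q hq =>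
    (norm_snd_le _).trans ((hgδ0 _ (hφU q hq).1).trans hδr)
  have hbound := hP k hV hV' hU (hφ0.of_le (by exact_mod_cast hk))
    (hφ.of_le (by norm_cast; omega)) (hg.of_le (by norm_cast; omega))
    (fun q hq => (hφU q hq).1) (fun q hq => (hL q hq _ (hsmall q hq)).1)
    (fun q hq => (hφU q hq).2) hM1
    (fun i hi y hy => (hM i hi y hy).trans (le_add_of_nonneg_left zero_le_one)) hgk
    (hgkp.trans (hgpδ.trans hδ1)) (η := δ)
    (fun z hz => by
      rw [← norm_iteratedFDerivWithin_one g (hU.uniqueDiffOn z hz)]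
      exact (hgp 1 hp z hz).trans hgpδ)
    (fun q hq => (mul_le_mul_of_nonneg_right (add_le_add le_rfl
      ((hL q hq _ (hsmall q hq)).2.trans (le_abs_self L))) hδ0).trans hδL)
  have hMe : 1 + CnormOn φ0 V' (k + 1) = ENNReal.ofReal M := by
    rw [hMdef, ENNReal.ofReal_add zero_le_one ENNReal.toReal_nonneg, ENNReal.ofReal_one,
      ENNReal.ofReal_toReal hφ0_top]
  refine (CnormOn_le_ofReal hbound).trans ?_
  rw [hMe, ← ENNReal.ofReal_pow (by linarith), ← ENNReal.ofReal_mul (by positivity),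
    ENNReal.ofReal_mul (aeval_nat_nonneg _ (by linarith)), ENNReal.ofReal_toReal hgk_top]
  gcongr
  refine (aeval_nat_le (P k) hM1).trans ?_
  gcongr
  · exact le_add_of_nonneg_right zero_le_one
  · exact Nat.le_succ _
end

section
/- Let n ≥ 1, let 0 < ε < 1/(4n), and let f : 𝔹(1) → ℂⁿ be a C¹ map with |f|_{1,1} < ε. Define maps g_l on 𝔹(1−2ε) inductively by g₀(z) = 0 and g_{l+1}(z) = −f(z + g_l(z)). Then for every l ∈ ℕ: g_l is well defined on 𝔹(1−2ε) with z + g_l(z) ∈ 𝔹(1) and sup_{z ∈ 𝔹(1−2ε)} |g_l(z)| < 2ε; moreover sup_{z ∈ 𝔹(1−2ε)} |g_l(z) + f(z + g_l(z))| ≤ (2n)^l · ε^{l+1} and sup_{z ∈ 𝔹(1−2ε)} |g_{l+1}(z) − g_l(z)| ≤ (2n)^l · ε^{l+1}. Consequently the sequence (g_l) converges uniformly on 𝔹(1−2ε) to a continuous map g with sup_{z ∈ 𝔹(1−2ε)} |g(z)| ≤ 2ε and g(z) + f(z + g(z)) = 0 for all z ∈ 𝔹(1−2ε). -/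
open scoped ENNReal

/-- The iteration `g₀ = 0`, `g_{l+1}(z) = -f(z + g_l(z))`. -/
noncomputable def iterSeq {d : ℕ} (f : (Fin d → ℝ) → (Fin d → ℝ)) :
    ℕ → (Fin d → ℝ) → (Fin d → ℝ)
  | 0 => fun _ => 0
  | l + 1 => fun z => -f (z + iterSeq f l z)

section

variable {d : ℕ} {f : (Fin d → ℝ) → (Fin d → ℝ)} {r ε : ℝ} {k : ℕ}

theorem abs_partialDeriv_le_of_CnormBall_lt (hε : 0 < ε)
    (hf : CnormBall f r k < ENNReal.ofReal ε) {z : Fin d → ℝ} (hz : z ∈ Metric.ball 0 r)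
    (i : Fin d) {L : List (Fin d)} (hL : L.length ≤ k) :
    |partialDeriv L (fun x => f x i) z| ≤ ε := by
  rw [← ENNReal.ofReal_le_ofReal_iff hε.le]
  refine le_trans ?_ hf.le
  unfold CnormBall
  refine le_iSup₂_of_le z hz (le_iSup_of_le i ?_)
  exact le_iSup (fun L : {L : List (Fin d) // L.length ≤ k} =>
    ENNReal.ofReal |partialDeriv L.1 (fun x => f x i) z|) ⟨L, hL⟩

theorem norm_le_of_CnormBall_lt (hε : 0 < ε) (hf : CnormBall f r k < ENNReal.ofReal ε)
    {z : Fin d → ℝ} (hz : z ∈ Metric.ball 0 r) : ‖f z‖ ≤ ε :=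
  (pi_norm_le_iff_of_nonneg hε.le).2 fun i =>
    abs_partialDeriv_le_of_CnormBall_lt hε hf hz i (L := []) (Nat.zero_le _)

/-- The operator norm of a functional on `ℝ^d` with the sup-norm is at most `d` times a bound
for its coefficients. -/
theorem norm_le_card_mul_of_apply_single_le (φ : (Fin d → ℝ) →L[ℝ] ℝ) (hε : 0 ≤ ε)
    (hφ : ∀ j, |φ (Pi.single j 1)| ≤ ε) : ‖φ‖ ≤ d * ε := by
  refine φ.opNorm_le_bound (by positivity) fun v => ?_
  have hv : φ v = ∑ j, v j * φ (Pi.single j 1) := by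
    conv_lhs => rw [pi_eq_sum_univ' v, map_sum]
    refine Finset.sum_congr rfl fun j _ => ?_
    rw [map_smul, smul_eq_mul]
  calc ‖φ v‖ ≤ ∑ j, ‖v j * φ (Pi.single j 1)‖ := hv ▸ norm_sum_le _ _
    _ ≤ ∑ _j : Fin d, ‖v‖ * ε := by
        refine Finset.sum_le_sum fun j _ => ?_
        rw [norm_mul]
        exact mul_le_mul (norm_le_pi_norm v j) (hφ j) (norm_nonneg _) (norm_nonneg _)
    _ = d * ε * ‖v‖ := by simp; ring

theorem norm_sub_le_of_CnormBall_lt (hε : 0 < ε) (hd : ContDiffOn ℝ 1 f (Metric.ball 0 r))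
    (hf : CnormBall f r 1 < ENNReal.ofReal ε) {x y : Fin d → ℝ}
    (hx : x ∈ Metric.ball 0 r) (hy : y ∈ Metric.ball 0 r) :
    ‖f y - f x‖ ≤ d * ε * ‖y - x‖ := by
  refine (pi_norm_le_iff_of_nonneg (by positivity)).2 fun i => ?_
  refine (convex_ball (0 : Fin d → ℝ) r).norm_image_sub_le_of_norm_fderiv_le (𝕜 := ℝ)
    (f := fun x => f x i) (fun z hz => ?_) (fun z hz => ?_) hx hy
  · exact differentiableAt_pi.1
      ((hd.differentiableOn one_ne_zero).differentiableAt (Metric.isOpen_ball.mem_nhds hz)) i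
  · exact norm_le_card_mul_of_apply_single_le _ hε.le fun j =>
      abs_partialDeriv_le_of_CnormBall_lt hε hf hz i (L := [j]) le_rfl

theorem norm_iterSeq_le (hε : 0 < ε) (hf : CnormBall f 1 k < ENNReal.ofReal ε) (l : ℕ)
    {z : Fin d → ℝ} (hz : z ∈ Metric.ball 0 (1 - 2 * ε)) :
    ‖iterSeq f l z‖ ≤ ε ∧ z + iterSeq f l z ∈ Metric.ball 0 1 := by
  rw [mem_ball_zero_iff] at hz
  have key : ∀ w : Fin d → ℝ, ‖w‖ ≤ ε → z + w ∈ Metric.ball 0 1 := fun w hw => by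
    rw [mem_ball_zero_iff]
    linarith [norm_add_le z w]
  induction l with
  | zero =>
    have h : ‖iterSeq f 0 z‖ ≤ ε := by simpa [iterSeq] using hε.le
    exact ⟨h, key _ h⟩
  | succ l ih =>
    have h : ‖iterSeq f (l + 1) z‖ ≤ ε := by
      simpa [iterSeq] using norm_le_of_CnormBall_lt hε hf ih.2
    exact ⟨h, key _ h⟩

theorem norm_iterSeq_succ_sub_le (hε : 0 < ε) (hd : ContDiffOn ℝ 1 f (Metric.ball 0 1))
    (hf : CnormBall f 1 1 < ENNReal.ofReal ε) (l : ℕ)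
    {z : Fin d → ℝ} (hz : z ∈ Metric.ball 0 (1 - 2 * ε)) :
    ‖iterSeq f (l + 1) z - iterSeq f l z‖ ≤ (d : ℝ) ^ l * ε ^ (l + 1) := by
  induction l with
  | zero => simpa [iterSeq] using (norm_iterSeq_le hε hf 1 hz).1
  | succ l ih =>
    have h := norm_sub_le_of_CnormBall_lt hε hd hf (norm_iterSeq_le hε hf (l + 1) hz).2
      (norm_iterSeq_le hε hf l hz).2
    rw [add_sub_add_left_eq_sub, norm_sub_rev (iterSeq f l z)] at h
    calc ‖iterSeq f (l + 1 + 1) z - iterSeq f (l + 1) z‖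
        = ‖f (z + iterSeq f l z) - f (z + iterSeq f (l + 1) z)‖ := by
          congr 1
          change -f (z + iterSeq f (l + 1) z) - -f (z + iterSeq f l z) = _
          abel
      _ ≤ d * ε * ((d : ℝ) ^ l * ε ^ (l + 1)) := h.trans (by gcongr)
      _ = (d : ℝ) ^ (l + 1) * ε ^ (l + 1 + 1) := by ring

theorem continuousOn_iterSeq (hε : 0 < ε) (hc : ContinuousOn f (Metric.ball 0 1))
    (hf : CnormBall f 1 k < ENNReal.ofReal ε) (l : ℕ) :
    ContinuousOn (iterSeq f l) (Metric.ball 0 (1 - 2 * ε)) := by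
  induction l with
  | zero => exact continuousOn_const
  | succ l ih =>
    exact (hc.comp (continuousOn_id.add ih) fun z hz => (norm_iterSeq_le hε hf l hz).2).neg

theorem exists_tendstoUniformlyOn_iterSeq (hε : 0 < ε) (hdε : d * ε < 1)
    (hd : ContDiffOn ℝ 1 f (Metric.ball 0 1)) (hf : CnormBall f 1 1 < ENNReal.ofReal ε) :
    ∃ g : (Fin d → ℝ) → (Fin d → ℝ),
      TendstoUniformlyOn (iterSeq f) g Filter.atTop (Metric.ball 0 (1 - 2 * ε)) := by
  have hdist : ∀ z ∈ Metric.ball (0 : Fin d → ℝ) (1 - 2 * ε), ∀ l,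
      dist (iterSeq f l z) (iterSeq f (l + 1) z) ≤ ε * (d * ε) ^ l := fun z hz l => by
    rw [dist_comm, dist_eq_norm]
    exact (norm_iterSeq_succ_sub_le hε hd hf l hz).trans_eq (by ring)
  have hlim : ∀ z, ∃ w, z ∈ Metric.ball (0 : Fin d → ℝ) (1 - 2 * ε) →
      Filter.Tendsto (fun l => iterSeq f l z) Filter.atTop (nhds w) := fun z => by
    by_cases hz : z ∈ Metric.ball (0 : Fin d → ℝ) (1 - 2 * ε)
    · obtain ⟨w, hw⟩ := cauchySeq_tendsto_of_complete
        (cauchySeq_of_le_geometric _ _ hdε (hdist z hz))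
      exact ⟨w, fun _ => hw⟩
    · exact ⟨0, fun h => absurd h hz⟩
  choose g hg using hlim
  refine ⟨g, Metric.tendstoUniformlyOn_iff.2 fun δ hδ => ?_⟩
  have hbound : Filter.Tendsto (fun l : ℕ => ε * (d * ε) ^ l / (1 - d * ε)) Filter.atTop
      (nhds 0) := by
    simpa using ((tendsto_pow_atTop_nhds_zero_of_lt_one (by positivity) hdε).const_mul
      ε).div_const (1 - d * ε)
  filter_upwards [hbound.eventually (gt_mem_nhds hδ)] with l hl z hz
  rw [dist_comm]
  exact (dist_le_of_le_geometric_of_tendsto _ _ hdε (hdist z hz) (hg z hz) l).trans_lt hl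

end

/-- **Convergence of the iteration scheme solving `g + f ∘ (id + g) = 0`.**
For `0 < ε < 1/(4n)` and a `C¹` map `f : 𝔹(1) → ℂⁿ ≅ ℝ^{2n}` with `|f|_{1,1} < ε`, the
iterates `g_l` are well defined on `𝔹(1-2ε)` (i.e. `z + g_l z ∈ 𝔹(1)` and `|g_l z| < 2ε`),
satisfy `|g_l z + f (z + g_l z)| ≤ (2n)^l ε^{l+1}` and `|g_{l+1} z - g_l z| ≤ (2n)^l ε^{l+1}`,
and converge uniformly on `𝔹(1-2ε)` to a continuous `g` with `|g| ≤ 2ε` solving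
`g z + f (z + g z) = 0`. -/
theorem iterSeq_converges (n : ℕ) (hn : 1 ≤ n) (ε : ℝ) (hε0 : 0 < ε)
    (hε : ε < 1 / (4 * n))
    (f : (Fin (2 * n) → ℝ) → (Fin (2 * n) → ℝ))
    (hf : ContDiffOn ℝ 1 f (Metric.ball 0 1))
    (hfnorm : CnormBall f 1 1 < ENNReal.ofReal ε) :
    (∀ l : ℕ, ∀ z ∈ Metric.ball (0 : Fin (2 * n) → ℝ) (1 - 2 * ε),
      z + iterSeq f l z ∈ Metric.ball (0 : Fin (2 * n) → ℝ) 1 ∧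
      ‖iterSeq f l z‖ < 2 * ε ∧
      ‖iterSeq f l z + f (z + iterSeq f l z)‖ ≤ (2 * n) ^ l * ε ^ (l + 1) ∧
      ‖iterSeq f (l + 1) z - iterSeq f l z‖ ≤ (2 * n) ^ l * ε ^ (l + 1)) ∧
    ∃ g : (Fin (2 * n) → ℝ) → (Fin (2 * n) → ℝ),
      ContinuousOn g (Metric.ball 0 (1 - 2 * ε)) ∧
      TendstoUniformlyOn (fun l => iterSeq f l) g Filter.atTop
        (Metric.ball 0 (1 - 2 * ε)) ∧
      ∀ z ∈ Metric.ball (0 : Fin (2 * n) → ℝ) (1 - 2 * ε),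
        ‖g z‖ ≤ 2 * ε ∧ g z + f (z + g z) = 0 := by
  have hn' : (0 : ℝ) < n := by exact_mod_cast hn
  have hdε : ((2 * n : ℕ) : ℝ) * ε < 1 := by
    rw [lt_div_iff₀ (by positivity)] at hε
    push_cast
    linarith
  have hsub : ∀ l, ∀ z ∈ Metric.ball (0 : Fin (2 * n) → ℝ) (1 - 2 * ε),
      ‖iterSeq f (l + 1) z - iterSeq f l z‖ ≤ (2 * n) ^ l * ε ^ (l + 1) := fun l z hz => by
    simpa using norm_iterSeq_succ_sub_le hε0 hf hfnorm l hz
  refine ⟨fun l z hz => ⟨(norm_iterSeq_le hε0 hfnorm l hz).2,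
    by linarith [(norm_iterSeq_le hε0 hfnorm l hz).1], ?_, hsub l z hz⟩, ?_⟩
  · rw [← norm_neg, neg_add_rev, ← sub_eq_add_neg]
    exact hsub l z hz
  obtain ⟨g, hg⟩ := exists_tendstoUniformlyOn_iterSeq hε0 hdε hf hfnorm
  refine ⟨g, hg.continuousOn (Filter.Frequently.of_forall
    (continuousOn_iterSeq hε0 hf.continuousOn hfnorm)), hg, fun z hz => ?_⟩
  have hgz := hg.tendsto_at hz
  have hnorm : ‖g z‖ ≤ 2 * ε :=
    (le_of_tendsto' hgz.norm fun l => (norm_iterSeq_le hε0 hfnorm l hz).1).trans (by linarith)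
  have hmem : z + g z ∈ Metric.ball (0 : Fin (2 * n) → ℝ) 1 := by
    rw [mem_ball_zero_iff] at hz ⊢
    linarith [norm_add_le z (g z)]
  have hfz := (hf.continuousOn.continuousAt (Metric.isOpen_ball.mem_nhds hmem)).tendsto.comp
    (hgz.const_add z)
  have heq : g z = -f (z + g z) :=
    tendsto_nhds_unique (hgz.comp (Filter.tendsto_add_atTop_nat 1)) hfz.neg
  exact ⟨hnorm, add_eq_zero_iff_eq_neg.2 heq⟩
end

section
/- Let d ≥ 1 and k ≥ 0 be integers, let 𝒰 ⊆ ℝ^d be a convex open set, let 𝒰₀ ⊆ ℝ^d be open and K ⊂ 𝒰₀ compact, let F : 𝒰 → ℝ be a C^{k+1} function, and let g : 𝒰₀ → ℝ^d be a C^k map with ‖g‖_{C^k(𝒰₀)} ≤ 1 and such that x ∈ 𝒰 and x + g(x) ∈ 𝒰 for all x ∈ 𝒰₀. Then the function x ↦ F(x + g(x)) − F(x) satisfies ‖F∘(id + g) − F‖_{C^k(K)} ≤ C · (1 + ‖F‖_{C^{k+1}(𝒰)}) · ‖g‖_{C^k(𝒰₀)}, where the constant C > 0 depends only on d and k. -/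
open scoped ENNReal

/-- `‖u‖_{C^k(S)}` for a scalar function `u` on `ℝ^d`: the supremum over `x ∈ S` and over
multi-indices `J` with `|J| ≤ k` of `|∂^J u(x)|` (valued in `[0,∞]`). -/
noncomputable def CnormS {d : ℕ} (u : (Fin d → ℝ) → ℝ) (S : Set (Fin d → ℝ)) (k : ℕ) : ℝ≥0∞ :=
  ⨆ x ∈ S, ⨆ L : {L : List (Fin d) // L.length ≤ k},
    ENNReal.ofReal |partialDeriv L.1 u x|

/-- `‖u‖_{C^k(S)}` for a map `u : ℝ^d → ℝ^d`: the supremum of the `C^k(S)` norms of its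
components. -/
noncomputable def CnormV {d : ℕ} (u : (Fin d → ℝ) → (Fin d → ℝ)) (S : Set (Fin d → ℝ))
    (k : ℕ) : ℝ≥0∞ :=
  ⨆ i : Fin d, CnormS (fun x => u x i) S k

/-- `u` is `C^n` on `V` and all its partial derivatives of order at most `n` are bounded by `a`
on `V`. -/
def PartialBound {d : ℕ} (V : Set (Fin d → ℝ)) (n : ℕ) (a : ℝ) (u : (Fin d → ℝ) → ℝ) : Prop :=
  ContDiffOn ℝ n u V ∧ ∀ L : List (Fin d), L.length ≤ n → ∀ x ∈ V, |partialDeriv L u x| ≤ a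

theorem partialDeriv_append_singleton {d : ℕ} (L : List (Fin d)) (j : Fin d)
    (u : (Fin d → ℝ) → ℝ) :
    partialDeriv (L ++ [j]) u = partialDeriv L (partialDeriv [j] u) := by
  induction L with
  | nil => rfl
  | cons i L ih => simp only [List.cons_append, partialDeriv] at ih ⊢; rw [ih]

theorem partialDeriv_eqOn {d : ℕ} {V : Set (Fin d → ℝ)} (hV : IsOpen V)
    {u v : (Fin d → ℝ) → ℝ} (h : Set.EqOn u v V) (L : List (Fin d)) :
    Set.EqOn (partialDeriv L u) (partialDeriv L v) V := by
  induction L with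
  | nil => exact h
  | cons i L ih =>
    intro x hx
    simp only [partialDeriv]
    rw [(ih.eventuallyEq_of_mem (hV.mem_nhds hx)).fderiv_eq]

theorem partialDeriv_zero {d : ℕ} (L : List (Fin d)) :
    partialDeriv L (fun _ => (0 : ℝ)) = fun _ => 0 := by
  induction L with
  | nil => rfl
  | cons i L ih => funext x; simp [partialDeriv, ih]

theorem ContDiffOn.partialDeriv_singleton {d n : ℕ} {V : Set (Fin d → ℝ)} (hV : IsOpen V)
    {u : (Fin d → ℝ) → ℝ} (h : ContDiffOn ℝ (n + 1 : ℕ) u V) (j : Fin d) :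
    ContDiffOn ℝ n (partialDeriv [j] u) V := by
  have h' : ContDiffOn ℝ n (fderiv ℝ u) V := h.fderiv_of_isOpen hV (by norm_cast)
  exact h'.clm_apply contDiffOn_const

namespace PartialBound

variable {d n : ℕ} {V : Set (Fin d → ℝ)} {a b : ℝ} {u v : (Fin d → ℝ) → ℝ}

theorem abs_le (h : PartialBound V n a u) {x : Fin d → ℝ} (hx : x ∈ V) : |u x| ≤ a :=
  h.2 [] (Nat.zero_le _) x hx

theorem differentiableAt (hV : IsOpen V) (h : PartialBound V (n + 1) a u) {x : Fin d → ℝ}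
    (hx : x ∈ V) : DifferentiableAt ℝ u x :=
  (h.1.contDiffAt (hV.mem_nhds hx)).differentiableAt (by norm_cast)

theorem congr (hV : IsOpen V) (h : PartialBound V n a u) (huv : Set.EqOn v u V) :
    PartialBound V n a v :=
  ⟨h.1.congr huv, fun L hL x hx => by rw [partialDeriv_eqOn hV huv L hx]; exact h.2 L hL x hx⟩

theorem mono (h : PartialBound V n a u) {m : ℕ} (hm : m ≤ n) (hab : a ≤ b) :
    PartialBound V m b u :=
  ⟨h.1.of_le (by exact_mod_cast hm), fun L hL x hx => (h.2 L (hL.trans hm) x hx).trans hab⟩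

theorem partialDeriv (hV : IsOpen V) (h : PartialBound V (n + 1) a u) (j : Fin d) :
    PartialBound V n a (partialDeriv [j] u) :=
  ⟨h.1.partialDeriv_singleton hV j, fun L hL x hx => by
    rw [← partialDeriv_append_singleton]
    exact h.2 _ (by simpa using hL) x hx⟩

theorem zero_order (hu : ContDiffOn ℝ 0 u V) (h : ∀ x ∈ V, |u x| ≤ a) :
    PartialBound V 0 a u :=
  ⟨hu, fun L hL x hx => by
    obtain rfl : L = [] := List.length_eq_zero_iff.1 (Nat.le_zero.1 hL)
    exact h x hx⟩

theorem succ (hu : ContDiffOn ℝ (n + 1 : ℕ) u V) (h : ∀ x ∈ V, |u x| ≤ a)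
    (h' : ∀ j, PartialBound V n a (_root_.partialDeriv [j] u)) : PartialBound V (n + 1) a u := by
  refine ⟨hu, fun L hL x hx => ?_⟩
  rcases L.eq_nil_or_concat with rfl | ⟨L, j, rfl⟩
  · exact h x hx
  · rw [List.concat_eq_append, partialDeriv_append_singleton]
    exact (h' j).2 L (by simpa using hL) x hx

theorem add (hV : IsOpen V) (hu : PartialBound V n a u) (hv : PartialBound V n b v) :
    PartialBound V n (a + b) (fun x => u x + v x) := by
  have habs : ∀ x ∈ V, |u x + v x| ≤ a + b := fun x hx =>
    (abs_add_le _ _).trans (add_le_add (hu.abs_le hx) (hv.abs_le hx))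
  induction n generalizing u v with
  | zero => exact zero_order (hu.1.add hv.1) habs
  | succ n ih =>
    refine succ (hu.1.add hv.1) habs fun j => ?_
    have hju := hu.partialDeriv hV j
    have hjv := hv.partialDeriv hV j
    refine (ih hju hjv fun x hx => (abs_add_le _ _).trans
      (add_le_add (hju.abs_le hx) (hjv.abs_le hx))).congr hV fun x hx => ?_
    simp [_root_.partialDeriv,
      fderiv_fun_add (hu.differentiableAt hV hx) (hv.differentiableAt hV hx)]

theorem zero (V : Set (Fin d → ℝ)) (n : ℕ) : PartialBound V n 0 (fun _ => 0) :=
  ⟨contDiffOn_const, fun L _ x _ => by simp [partialDeriv_zero]⟩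

theorem sum (hV : IsOpen V) {ι : Type*} (s : Finset ι) {w : ι → (Fin d → ℝ) → ℝ}
    (h : ∀ i ∈ s, PartialBound V n a (w i)) :
    PartialBound V n (s.card * a) (fun x => ∑ i ∈ s, w i x) := by
  classical
  induction s using Finset.induction_on with
  | empty => simpa using zero V n
  | insert i s hi ih =>
    have := (h i (Finset.mem_insert_self i s)).add hV
      (ih fun j hj => h j (Finset.mem_insert_of_mem hj))
    simp only [Finset.sum_insert hi, Finset.card_insert_of_notMem hi]
    convert this using 1
    push_cast
    ring

theorem mul (hV : IsOpen V) (ha : 0 ≤ a) (hb : 0 ≤ b) (hu : PartialBound V n a u)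
    (hv : PartialBound V n b v) :
    PartialBound V n (2 ^ n * (a * b)) (fun x => u x * v x) := by
  induction n generalizing a b u v with
  | zero =>
    refine zero_order (hu.1.mul hv.1) fun x hx => ?_
    rw [abs_mul, pow_zero, one_mul]
    exact mul_le_mul (hu.abs_le hx) (hv.abs_le hx) (abs_nonneg _) ha
  | succ n ih =>
    have hab := mul_nonneg ha hb
    refine succ (hu.1.mul hv.1) (fun x hx => ?_) fun j => ?_
    · rw [abs_mul]
      exact (mul_le_mul (hu.abs_le hx) (hv.abs_le hx) (abs_nonneg _) ha).trans
        (le_mul_of_one_le_left hab (one_le_pow₀ one_le_two))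
    · have h1 := ih ha hb (hu.mono n.le_succ le_rfl) (hv.partialDeriv hV j)
      have h2 := ih hb ha (hv.mono n.le_succ le_rfl) (hu.partialDeriv hV j)
      refine ((h1.add hV h2).mono le_rfl (le_of_eq (by ring))).congr hV fun x hx => ?_
      simp [_root_.partialDeriv,
        fderiv_fun_mul (hu.differentiableAt hV hx) (hv.differentiableAt hV hx)]

end PartialBound

/-- A functional on `ℝ^d` is determined by its values on the coordinate vectors. -/
theorem ContinuousLinearMap.apply_eq_sum_single {d : ℕ} (T : (Fin d → ℝ) →L[ℝ] ℝ)
    (v : Fin d → ℝ) : T v = ∑ i, v i * T (Pi.single i 1) := by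
  conv_lhs => rw [pi_eq_sum_univ' v]
  simp [map_sum]

theorem Convex.abs_sub_le_of_partialBound {d : ℕ} {U : Set (Fin d → ℝ)} (hU : Convex ℝ U)
    (hUo : IsOpen U) {A : ℝ} {F : (Fin d → ℝ) → ℝ} (hF : PartialBound U 1 A F)
    {x y : Fin d → ℝ} (hx : x ∈ U) (hy : y ∈ U) : |F y - F x| ≤ d * A * ‖y - x‖ := by
  have hA : 0 ≤ A := (abs_nonneg _).trans (hF.abs_le hx)
  refine hU.norm_image_sub_le_of_norm_fderiv_le (𝕜 := ℝ)
    (fun z hz => hF.differentiableAt (n := 0) hUo hz) (fun z hz => ?_) hx hy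
  refine ContinuousLinearMap.opNorm_le_bound _ (by positivity) fun v => ?_
  rw [ContinuousLinearMap.apply_eq_sum_single]
  calc ‖∑ i, v i * fderiv ℝ F z (Pi.single i 1)‖ ≤ ∑ _i : Fin d, ‖v‖ * A := by
        refine norm_sum_le_of_le _ fun i _ => ?_
        rw [norm_mul]
        exact mul_le_mul (norm_le_pi_norm v i) (hF.2 [i] le_rfl z hz) (norm_nonneg _)
          (norm_nonneg _)
    _ = d * A * ‖v‖ := by simp; ring

theorem partialDeriv_comp_perturbation_sub {d : ℕ} {F : (Fin d → ℝ) → ℝ}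
    {g : (Fin d → ℝ) → (Fin d → ℝ)} {x : Fin d → ℝ} (hFx : DifferentiableAt ℝ F x)
    (hFg : DifferentiableAt ℝ F (x + g x)) (hg : DifferentiableAt ℝ g x) (j : Fin d) :
    partialDeriv [j] (fun x => F (x + g x) - F x) x =
      (partialDeriv [j] F (x + g x) - partialDeriv [j] F x) +
        ∑ i, ((partialDeriv [i] F (x + g x) - partialDeriv [i] F x) *
            partialDeriv [j] (fun x => g x i) x +
          partialDeriv [i] F x * partialDeriv [j] (fun x => g x i) x) := by
  have hid : HasFDerivAt (fun x => x + g x) (ContinuousLinearMap.id ℝ _ + fderiv ℝ g x) x :=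
    (hasFDerivAt_id x).add hg.hasFDerivAt
  have h := ((hFg.hasFDerivAt.comp x hid).sub hFx.hasFDerivAt).fderiv
  have hgi : ∀ i, fderiv ℝ (fun x => g x i) x (Pi.single j 1) =
      fderiv ℝ g x (Pi.single j 1) i := fun i => by
    rw [((hasFDerivAt_pi'.1 hg.hasFDerivAt) i).fderiv]; rfl
  simp only [partialDeriv, hgi]
  have h' : fderiv ℝ (fun x => F (x + g x) - F x) x = _ := h
  rw [h']
  simp only [sub_apply, ContinuousLinearMap.comp_apply, add_apply, map_add,
    ContinuousLinearMap.id_apply]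
  rw [ContinuousLinearMap.apply_eq_sum_single _ (fderiv ℝ g x (Pi.single j 1))]
  have : ∀ p q r : Fin d → ℝ, ∑ i, ((p i - q i) * r i + q i * r i) = ∑ i, r i * p i :=
    fun p q r => Finset.sum_congr rfl fun i _ => by ring
  rw [this]
  ring

theorem exists_partialBound_comp_perturbation (d k : ℕ) :
    ∃ C : ℝ, 0 ≤ C ∧ ∀ (U U₀ : Set (Fin d → ℝ)), Convex ℝ U → IsOpen U → IsOpen U₀ →
      ∀ (A ε : ℝ), 0 ≤ A → 0 ≤ ε → ε ≤ 1 →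
      ∀ F : (Fin d → ℝ) → ℝ, PartialBound U (k + 1) A F →
      ∀ g : (Fin d → ℝ) → (Fin d → ℝ), (∀ i, PartialBound U₀ k ε (fun x => g x i)) →
        (∀ x ∈ U₀, x ∈ U ∧ x + g x ∈ U) →
        PartialBound U₀ k (C * (A * ε)) (fun x => F (x + g x) - F x) := by
  have habs : ∀ (k : ℕ) (U U₀ : Set (Fin d → ℝ)), Convex ℝ U → IsOpen U →
      ∀ (A ε : ℝ), 0 ≤ A → 0 ≤ ε →
      ∀ F : (Fin d → ℝ) → ℝ, PartialBound U (k + 1) A F →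
      ∀ g : (Fin d → ℝ) → (Fin d → ℝ), (∀ i, PartialBound U₀ k ε (fun x => g x i)) →
        (∀ x ∈ U₀, x ∈ U ∧ x + g x ∈ U) →
        ∀ x ∈ U₀, |F (x + g x) - F x| ≤ d * (A * ε) := by
    intro k U U₀ hU hUo A ε hA hε F hF g hg hgU x hx
    refine (hU.abs_sub_le_of_partialBound hUo (hF.mono (Nat.le_add_left 1 k) le_rfl)
      (hgU x hx).1 (hgU x hx).2).trans ?_
    rw [add_sub_cancel_left, mul_assoc]
    gcongr
    exact (pi_norm_le_iff_of_nonneg hε).2 fun i => (hg i).abs_le hx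
  have hreg : ∀ (k : ℕ) (U U₀ : Set (Fin d → ℝ)) (A ε : ℝ),
      ∀ F : (Fin d → ℝ) → ℝ, PartialBound U (k + 1) A F →
      ∀ g : (Fin d → ℝ) → (Fin d → ℝ), (∀ i, PartialBound U₀ k ε (fun x => g x i)) →
        (∀ x ∈ U₀, x ∈ U ∧ x + g x ∈ U) →
        ContDiffOn ℝ k (fun x => F (x + g x) - F x) U₀ := by
    intro k U U₀ A ε F hF g hg hgU
    have hF' := (hF.mono k.le_succ le_rfl).1
    have hg' : ContDiffOn ℝ k g U₀ := contDiffOn_pi.2 fun i => (hg i).1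
    exact (hF'.comp (contDiffOn_id.add hg') fun x hx => (hgU x hx).2).sub
      (hF'.mono fun x hx => (hgU x hx).1)
  induction k with
  | zero =>
    refine ⟨d, by positivity, fun U U₀ hU hUo _ A ε hA hε _ F hF g hg hgU => ?_⟩
    exact .zero_order (hreg 0 U U₀ A ε F hF g hg hgU) (habs 0 U U₀ hU hUo A ε hA hε F hF g hg hgU)
  | succ k ih =>
    obtain ⟨C, hC, ih⟩ := ih
    refine ⟨d + (C + d * (2 ^ k * C + 2 ^ k)), by positivity,
      fun U U₀ hU hUo hU₀ A ε hA hε hε1 F hF g hg hgU => ?_⟩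
    have hAε : 0 ≤ A * ε := by positivity
    refine .succ (hreg _ U U₀ A ε F hF g hg hgU) (fun x hx => ?_) fun j => ?_
    · refine (habs _ U U₀ hU hUo A ε hA hε F hF g hg hgU x hx).trans ?_
      gcongr
      exact le_add_of_nonneg_right (by positivity)
    · have hD := fun i => ih U U₀ hU hUo hU₀ A ε hA hε hε1 _ (hF.partialDeriv hUo i) g
        (fun i => (hg i).mono k.le_succ le_rfl) hgU
      have hFi : ∀ i, PartialBound U₀ k A (partialDeriv [i] F) := fun i =>
        have h := (hF.partialDeriv hUo i).mono k.le_succ le_rfl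
        ⟨h.1.mono fun x hx => (hgU x hx).1, fun L hL x hx => h.2 L hL x (hgU x hx).1⟩
      have hgj := fun i => (hg i).partialDeriv hU₀ j
      have hS := PartialBound.sum hU₀ Finset.univ fun i _ =>
        (((hD i).mul hU₀ (by positivity) hε (hgj i)).add hU₀
          ((hFi i).mul hU₀ hA hε (hgj i)))
      refine (((hD j).add hU₀ hS).mono le_rfl ?_).congr hU₀ fun x hx => ?_
      · rw [Finset.card_univ, Fintype.card_fin]
        have h1 : C * (A * ε) * ε ≤ C * (A * ε) := mul_le_of_le_one_right (by positivity) hε1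
        calc C * (A * ε) + d * (2 ^ k * (C * (A * ε) * ε) + 2 ^ k * (A * ε))
            ≤ C * (A * ε) + d * (2 ^ k * (C * (A * ε)) + 2 ^ k * (A * ε)) := by gcongr
          _ = (C + d * (2 ^ k * C + 2 ^ k)) * (A * ε) := by ring
          _ ≤ _ := mul_le_mul_of_nonneg_right (le_add_of_nonneg_left d.cast_nonneg) hAε
      · exact partialDeriv_comp_perturbation_sub (hF.differentiableAt hUo (hgU x hx).1)
          (hF.differentiableAt hUo (hgU x hx).2)
          (differentiableAt_pi.2 fun i => (hg i).differentiableAt hU₀ hx) j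

theorem PartialBound.cnormS_le {d n : ℕ} {V : Set (Fin d → ℝ)} {a : ℝ} {u : (Fin d → ℝ) → ℝ}
    (h : PartialBound V n a u) {S : Set (Fin d → ℝ)} (hS : S ⊆ V) :
    CnormS u S n ≤ ENNReal.ofReal a :=
  iSup₂_le fun x hx => iSup_le fun L => ENNReal.ofReal_le_ofReal (h.2 L.1 L.2 x (hS hx))

theorem partialBound_of_cnormS_le {d n : ℕ} {V : Set (Fin d → ℝ)} {a : ℝ≥0∞}
    {u : (Fin d → ℝ) → ℝ} (hu : ContDiffOn ℝ n u V) (h : CnormS u V n ≤ a) (ha : a ≠ ⊤) :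
    PartialBound V n a.toReal u := by
  refine ⟨hu, fun L hL x hx => (ENNReal.ofReal_le_iff_le_toReal ha).1 (le_trans ?_ h)⟩
  exact le_iSup₂_of_le x hx
    (le_iSup (fun L : {L : List (Fin d) // L.length ≤ n} =>
      ENNReal.ofReal |partialDeriv L.1 u x|) ⟨L, hL⟩)

/-- **Tame estimate for `F ∘ (id + g) - F`.**
There is `C > 0` depending only on `d` and `k` such that for every convex open `𝒰 ⊆ ℝ^d`,
every open `𝒰₀` with compact `K ⊆ 𝒰₀`, every `C^{k+1}` function `F` on `𝒰` and every `C^k`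
map `g` on `𝒰₀` with `‖g‖_{C^k(𝒰₀)} ≤ 1` and `x, x + g x ∈ 𝒰` for `x ∈ 𝒰₀`, one has
`‖F∘(id+g) - F‖_{C^k(K)} ≤ C (1 + ‖F‖_{C^{k+1}(𝒰)}) ‖g‖_{C^k(𝒰₀)}`. -/
theorem comp_perturbation_Ck_estimate (d k : ℕ) (hd : 1 ≤ d) :
    ∃ C > (0 : ℝ), ∀ (U U₀ K : Set (Fin d → ℝ)),
      Convex ℝ U → IsOpen U → IsOpen U₀ → IsCompact K → K ⊆ U₀ →
      ∀ F : (Fin d → ℝ) → ℝ, ContDiffOn ℝ (k + 1) F U →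
      ∀ g : (Fin d → ℝ) → (Fin d → ℝ), ContDiffOn ℝ k g U₀ →
        CnormV g U₀ k ≤ 1 →
        (∀ x ∈ U₀, x ∈ U ∧ x + g x ∈ U) →
        CnormS (fun x => F (x + g x) - F x) K k ≤
          ENNReal.ofReal C * (1 + CnormS F U (k + 1)) * CnormV g U₀ k := by
  obtain ⟨C, hC, h⟩ := exists_partialBound_comp_perturbation d k
  refine ⟨C + 1, by positivity, fun U U₀ K hU hUo hU₀ _ hKU F hF g hg hg1 hgU => ?_⟩
  have hgtop : CnormV g U₀ k ≠ ⊤ := ne_top_of_le_ne_top ENNReal.one_ne_top hg1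
  have hgi : ∀ i, PartialBound U₀ k (CnormV g U₀ k).toReal (fun x => g x i) := fun i =>
    partialBound_of_cnormS_le (contDiffOn_pi.1 hg i)
      (le_iSup (fun i => CnormS (fun x => g x i) U₀ k) i) hgtop
  by_cases hg0 : CnormV g U₀ k = 0
  · have hz : ∀ x ∈ U₀, g x = 0 := fun x hx => funext fun i => by
      simpa [hg0] using (hgi i).abs_le hx
    have hb := (PartialBound.zero U₀ k).congr hU₀ (v := fun x => F (x + g x) - F x)
      fun x hx => by simp [hz x hx]
    exact (hb.cnormS_le hKU).trans (by simp)
  by_cases hFtop : CnormS F U (k + 1) = ⊤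
  · rw [hFtop, add_top, ENNReal.mul_top (by simpa using by positivity), ENNReal.top_mul hg0]
    exact le_top
  have hFb := partialBound_of_cnormS_le (n := k + 1) (by exact_mod_cast hF) le_rfl hFtop
  have hb := h U U₀ hU hUo hU₀ _ _ ENNReal.toReal_nonneg ENNReal.toReal_nonneg
    (ENNReal.toReal_le_of_le_ofReal zero_le_one (by simpa using hg1)) F hFb g hgi hgU
  refine (hb.cnormS_le hKU).trans ?_
  rw [ENNReal.ofReal_mul hC, ENNReal.ofReal_mul ENNReal.toReal_nonneg,
    ENNReal.ofReal_toReal hFtop, ENNReal.ofReal_toReal hgtop, ← mul_assoc]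
  gcongr
  · exact le_add_of_nonneg_right zero_le_one
  · exact le_add_self
end

section
/- Let d₁, d₂ ≥ 1 and p ≥ 0 be integers, let K₁ ⊂ ℝ^{d₁} and K₂ ⊂ ℝ^{d₂} be compact sets, let Ω₁ ⊇ K₁ and Ω₂ ⊇ K₂ be open sets, and let u : Ω₁ × Ω₂ → ℂ be a C^p function. Then for every ε > 0 there exist L ∈ ℕ, C^p functions h₁,…,h_L : Ω₁ → ℂ, and C^p functions N₁,…,N_L : Ω₂ → ℂ such that ‖u − Σ_{j=1}^L h_j ⊗ N_j‖_{C^p(K₁ × K₂)} < ε, where (h_j ⊗ N_j)(x,y) = h_j(x)·N_j(y). -/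
open scoped ENNReal

/-- `‖u‖_{C^p(T)}`: the supremum over `x ∈ T` of the norms of the derivatives of `u` of
order at most `p`, the derivatives being taken within the (open) set `S` (valued in
`[0,∞]`). -/
noncomputable def CnormWithin {E F : Type*} [NormedAddCommGroup E] [NormedSpace ℝ E]
    [NormedAddCommGroup F] [NormedSpace ℝ F]
    (u : E → F) (S T : Set E) (p : ℕ) : ℝ≥0∞ :=
  ⨆ j : Fin (p + 1), ⨆ x ∈ T, ENNReal.ofReal ‖iteratedFDerivWithin ℝ j u S x‖

open MeasureTheory Set Topology Filter
open scoped ContDiff Convolution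

lemma integrable_prodMk_left {H E F : Type*} [TopologicalSpace H] [R1Space H]
    [MeasurableSpace H] [OpensMeasurableSpace H] [TopologicalSpace E] [NormedAddCommGroup F]
    {μ : Measure H} [IsFiniteMeasureOnCompacts μ]
    {f : H × E → F} (hf : Continuous f) {k : Set H} (hk : IsCompact k)
    (hfk : ∀ s ∉ k, ∀ z, f (s, z) = 0) (z : E) : Integrable (fun s => f (s, z)) μ :=
  Continuous.integrable_of_hasCompactSupport (by fun_prop)
    (HasCompactSupport.intro hk fun s hs => hfk s hs z)

lemma hasFDerivAt_integral_of_compact {H E F : Type*} [TopologicalSpace H] [T2Space H]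
    [MeasurableSpace H] [OpensMeasurableSpace H] [NormedAddCommGroup E] [NormedSpace ℝ E]
    [ProperSpace E] [NormedAddCommGroup F] [NormedSpace ℝ F]
    {μ : Measure H} [IsFiniteMeasureOnCompacts μ] {f : H × E → F} {f' : H × E → E →L[ℝ] F}
    (hf : Continuous f) (hf' : Continuous f') {k : Set H} (hk : IsCompact k)
    (hfk : ∀ s ∉ k, ∀ z, f (s, z) = 0) (hfk' : ∀ s ∉ k, ∀ z, f' (s, z) = 0)
    (h : ∀ s z, HasFDerivAt (fun w => f (s, w)) (f' (s, z)) z) (z : E) :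
    HasFDerivAt (fun z => ∫ s, f (s, z) ∂μ) (∫ s, f' (s, z) ∂μ) z := by
  obtain ⟨C, hC⟩ := (hk.prod (isCompact_closedBall z 1)).exists_bound_of_continuousOn
    hf'.continuousOn
  refine hasFDerivAt_integral_of_dominated_of_fderiv_le (bound := k.indicator fun _ => C)
    (F := fun z s => f (s, z)) (F' := fun z s => f' (s, z))
    (Metric.ball_mem_nhds z one_pos)
    (.of_forall fun w => (integrable_prodMk_left hf hk hfk w).aestronglyMeasurable)
    (integrable_prodMk_left hf hk hfk z)
    (integrable_prodMk_left hf' hk hfk' z).aestronglyMeasurable ?_ ?_ ?_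
  · refine .of_forall fun s w hw => ?_
    by_cases hs : s ∈ k
    · rw [indicator_of_mem hs]
      exact hC (s, w) ⟨hs, Metric.ball_subset_closedBall hw⟩
    · simp [hs, hfk' s hs]
  · exact (integrable_indicator_iff hk.measurableSet).2 (integrableOn_const hk.measure_ne_top)
  · exact .of_forall fun s w _ => h s w

section ParametricIntegral

variable {H E F : Type*} [NormedAddCommGroup H] [NormedSpace ℝ H]
  [NormedAddCommGroup E] [NormedSpace ℝ E] [NormedAddCommGroup F] [NormedSpace ℝ F]

/-- The derivative of order `m` in the second variable, as a restriction of the total one. -/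
lemma iteratedFDeriv_prodMk_left {p : ℕ} {G : H × E → F} (hG : ContDiff ℝ p G)
    {m : ℕ} (hm : m ≤ p) (s : H) (z : E) :
    iteratedFDeriv ℝ m (fun w => G (s, w)) z =
      (iteratedFDeriv ℝ m G (s, z)).compContinuousLinearMap
        fun _ => ContinuousLinearMap.inr ℝ H E := by
  have h1 : (fun w => G (s, w)) =
      (fun q => G ((s, 0) + q)) ∘ (ContinuousLinearMap.inr ℝ H E) := by
    ext w; simp
  have h2 : ContDiff ℝ p (fun q : H × E => G ((s, 0) + q)) := by fun_prop
  rw [h1, ContinuousLinearMap.iteratedFDeriv_comp_right _ h2 z (by exact_mod_cast hm),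
    iteratedFDeriv_comp_add_left]
  simp

lemma continuous_iteratedFDeriv_prodMk_left {p : ℕ} {G : H × E → F} (hG : ContDiff ℝ p G)
    {m : ℕ} (hm : m ≤ p) :
    Continuous fun q : H × E => iteratedFDeriv ℝ m (fun w => G (q.1, w)) q.2 := by
  simp_rw [iteratedFDeriv_prodMk_left hG hm]
  exact (ContinuousMultilinearMap.compContinuousLinearMapL
    (fun _ : Fin m => ContinuousLinearMap.inr ℝ H E)).continuous.comp
    (hG.continuous_iteratedFDeriv (by exact_mod_cast hm))

variable [ProperSpace E] [MeasurableSpace H] [BorelSpace H] {μ : Measure H}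
  [IsFiniteMeasureOnCompacts μ]

lemma iteratedFDeriv_integral_of_compact [CompleteSpace F] {p : ℕ} {G : H × E → F}
    (hG : ContDiff ℝ p G) {k : Set H} (hk : IsCompact k) (hGk : ∀ s ∉ k, ∀ z, G (s, z) = 0)
    {m : ℕ} (hm : m ≤ p) (z : E) :
    iteratedFDeriv ℝ m (fun z => ∫ s, G (s, z) ∂μ) z =
      ∫ s, iteratedFDeriv ℝ m (fun w => G (s, w)) z ∂μ := by
  have hzero : ∀ m : ℕ, ∀ s ∉ k, ∀ z, iteratedFDeriv ℝ m (fun w => G (s, w)) z = 0 := by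
    intro m s hs z
    have : (fun w => G (s, w)) = fun _ => 0 := funext fun w => hGk s hs w
    rw [this]
    simp
  have hc : ∀ {m : ℕ}, m ≤ p → Continuous fun q : H × E =>
      iteratedFDeriv ℝ m (fun w => G (q.1, w)) q.2 :=
    fun hm => continuous_iteratedFDeriv_prodMk_left hG hm
  have hint : ∀ {m : ℕ}, m ≤ p → ∀ z, Integrable (fun s =>
      iteratedFDeriv ℝ m (fun w => G (s, w)) z) μ := fun hm z =>
    integrable_prodMk_left (hc hm) hk (fun s hs z => hzero _ s hs z) z
  have hT : HasFTaylorSeriesUpTo p (fun z => ∫ s, G (s, z) ∂μ)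
      (fun z m => ∫ s, iteratedFDeriv ℝ m (fun w => G (s, w)) z ∂μ) := by
    refine ⟨fun z => ?_, fun m hm z => ?_, fun m hm => ?_⟩
    · rw [ContinuousMultilinearMap.curry0, ContinuousMultilinearMap.integral_apply
        (hint (Nat.zero_le _) z)]
      simp
    · have hm' : m < p := by exact_mod_cast hm
      let c : (E [×(m + 1)]→L[ℝ] F) →L[ℝ] (E →L[ℝ] E [×m]→L[ℝ] F) :=
        (continuousMultilinearCurryLeftEquiv ℝ
          (fun _ : Fin (m + 1) => E) F).toContinuousLinearEquiv.toContinuousLinearMap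
      change HasFDerivAt _ (c (∫ s, iteratedFDeriv ℝ (m + 1) (fun w => G (s, w)) z ∂μ)) z
      rw [← ContinuousLinearMap.integral_comp_comm (𝕜 := ℝ) (Fₗ := E →L[ℝ] E [×m]→L[ℝ] F) c
        (hint hm' z)]
      refine hasFDerivAt_integral_of_compact
        (f := fun q => iteratedFDeriv ℝ m (fun w => G (q.1, w)) q.2)
        (f' := fun q => (iteratedFDeriv ℝ (m + 1) (fun w => G (q.1, w)) q.2).curryLeft)
        (hc hm'.le) (c.continuous.comp (hc hm')) hk (hzero m) ?_ ?_ z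
      · intro s hs z
        change c _ = 0
        simp only [hzero _ s hs z, map_zero]
      · intro s z
        have hGs : ContDiff ℝ p fun w => G (s, w) := by fun_prop
        exact (contDiff_iff_ftaylorSeries.1 hGs).fderiv m hm z
    · rw [← continuousOn_univ]
      refine continuousOn_integral_of_compact_support (μ := μ) hk
        (f := fun z s => iteratedFDeriv ℝ m (fun w => G (s, w)) z) ?_ ?_
      · exact ((hc (by exact_mod_cast hm)).comp continuous_swap).continuousOn
      · exact fun z s _ hs => hzero m s hs z
  exact (hT.eq_iteratedFDeriv (by exact_mod_cast hm) z).symm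

end ParametricIntegral

lemma Submodule.integral_mem_of_isClosed {α X : Type*} [MeasurableSpace α] {μ : Measure α}
    [NormedAddCommGroup X] [NormedSpace ℝ X] [CompleteSpace X] (S : Submodule ℝ X)
    (hS : IsClosed (S : Set X)) {f : α → X} (hfi : Integrable f μ) (hf : ∀ a, f a ∈ S) :
    ∫ a, f a ∂μ ∈ S := by
  have := hS
  rw [← Submodule.Quotient.mk_eq_zero]
  change S.mkQL _ = 0
  rw [← S.mkQL.integral_comp_comm hfi]
  have : ∀ a, S.mkQL (f a) = 0 := fun a => by simpa using hf a
  simp [this]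

section Jets

variable {H E F : Type*} [NormedAddCommGroup H] [NormedSpace ℝ H]
  [NormedAddCommGroup E] [NormedSpace ℝ E] [NormedAddCommGroup F] [NormedSpace ℝ F] {p : ℕ}

/-- The space of jets of order `p`. -/
def Jet (p : ℕ) (E F : Type*) [NormedAddCommGroup E] [NormedSpace ℝ E] [NormedAddCommGroup F]
    [NormedSpace ℝ F] : Type _ :=
  (j : Fin (p + 1)) → ContinuousMultilinearMap ℝ (fun _ : Fin j => E) F

namespace Jet

noncomputable instance : NormedAddCommGroup (Jet p E F) :=
  inferInstanceAs (NormedAddCommGroup ((j : Fin (p + 1)) → _))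

noncomputable instance : NormedSpace ℝ (Jet p E F) :=
  inferInstanceAs (NormedSpace ℝ ((j : Fin (p + 1)) → _))

instance [CompleteSpace F] : CompleteSpace (Jet p E F) :=
  inferInstanceAs (CompleteSpace ((j : Fin (p + 1)) →
    ContinuousMultilinearMap ℝ (fun _ : Fin j => E) F))

@[ext]
lemma ext {a b : Jet p E F} (h : ∀ j, a j = b j) : a = b := funext h

@[simp]
lemma zero_apply (j : Fin (p + 1)) : (0 : Jet p E F) j = 0 := rfl

@[simp]
lemma add_apply (a b : Jet p E F) (j : Fin (p + 1)) : (a + b) j = a j + b j := rfl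

@[simp]
lemma sub_apply (a b : Jet p E F) (j : Fin (p + 1)) : (a - b) j = a j - b j := rfl

@[simp]
lemma smul_apply (c : ℝ) (a : Jet p E F) (j : Fin (p + 1)) : (c • a) j = c • a j := rfl

lemma norm_apply_le (a : Jet p E F) (j : Fin (p + 1)) : ‖a j‖ ≤ ‖a‖ :=
  norm_le_pi_norm (ι := Fin (p + 1)) a j

/-- The component of order `j`, as a continuous linear map. -/
noncomputable def proj (j : Fin (p + 1)) :
    Jet p E F →L[ℝ] ContinuousMultilinearMap ℝ (fun _ : Fin j => E) F :=
  ContinuousLinearMap.proj (R := ℝ)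
    (φ := fun j : Fin (p + 1) => ContinuousMultilinearMap ℝ (fun _ : Fin j => E) F) j

end Jet

/-- The family `s ↦ (Dʲ G(s, ·) on K)_{j ≤ p}` of jets of a `C^p` function `G`, as a continuous
map into a space of continuous functions on `K`. -/
noncomputable def jetFamily (K : Set E) {G : H × E → F} (hG : ContDiff ℝ p G) :
    C(H, C(K, Jet p E F)) :=
  ContinuousMap.curry
    ⟨fun q j => iteratedFDeriv ℝ j (fun w => G (q.1, w)) q.2, continuous_pi fun j =>
      (continuous_iteratedFDeriv_prodMk_left hG (Nat.lt_succ_iff.1 j.2)).comp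
        (continuous_id.prodMap continuous_subtype_val)⟩

@[simp]
lemma jetFamily_apply (K : Set E) {G : H × E → F} (hG : ContDiff ℝ p G) (s : H) (z : K)
    (j : Fin (p + 1)) :
    jetFamily K hG s z j = iteratedFDeriv ℝ j (fun w => G (s, w)) z := rfl

variable [MeasurableSpace H] [BorelSpace H] {μ : Measure H} [IsFiniteMeasureOnCompacts μ]

lemma integrable_jetFamily (K : Set E) [CompactSpace K] {G : H × E → F} (hG : ContDiff ℝ p G)
    {k : Set H} (hk : IsCompact k) (hGk : ∀ s ∉ k, ∀ z, G (s, z) = 0) :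
    Integrable (fun s => jetFamily K hG s) μ := by
  refine (jetFamily K hG).continuous.integrable_of_hasCompactSupport
    (HasCompactSupport.intro hk fun s hs => ?_)
  ext z j : 2
  have : (fun w => G (s, w)) = fun _ => 0 := funext fun w => hGk s hs w
  simp [this]

lemma integral_jetFamily_apply [ProperSpace E] [CompleteSpace F] (K : Set E) [CompactSpace K]
    {G : H × E → F} (hG : ContDiff ℝ p G)
    {k : Set H} (hk : IsCompact k) (hGk : ∀ s ∉ k, ∀ z, G (s, z) = 0) (z : K)
    (j : Fin (p + 1)) :
    (∫ s, jetFamily K hG s ∂μ) z j = iteratedFDeriv ℝ j (fun z => ∫ s, G (s, z) ∂μ) z := by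
  have hi := integrable_jetFamily (μ := μ) K hG hk hGk
  rw [iteratedFDeriv_integral_of_compact hG hk hGk (Nat.lt_succ_iff.1 j.2)]
  exact (((Jet.proj j).comp (ContinuousMap.evalCLM ℝ z)).integral_comp_comm hi).symm

end Jets

section Tensor

variable {E₁ E₂ : Type*} [NormedAddCommGroup E₁] [NormedSpace ℝ E₁]
  [NormedAddCommGroup E₂] [NormedSpace ℝ E₂] {p : ℕ}

/-- The jets on `K` of finite sums of tensor products of `C^p` functions. -/
def tensorJets (p : ℕ) (K : Set (E₁ × E₂)) : Submodule ℝ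
    C(K, Jet p (E₁ × E₂) ℂ) where
  carrier := {A | ∃ (L : ℕ) (h : Fin L → E₁ → ℂ) (N : Fin L → E₂ → ℂ),
    (∀ i, ContDiff ℝ p (h i)) ∧ (∀ i, ContDiff ℝ p (N i)) ∧
    ∀ z j, A z j = iteratedFDeriv ℝ j (fun z : E₁ × E₂ => ∑ i, h i z.1 * N i z.2) z}
  zero_mem' := ⟨0, fun _ _ => 0, fun _ _ => 0, fun _ => contDiff_const, fun _ => contDiff_const,
    fun z j => by simp⟩
  add_mem' := by
    rintro A B ⟨L, h, N, hh, hN, hA⟩ ⟨L', h', N', hh', hN', hB⟩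
    refine ⟨L + L', Fin.append h h', Fin.append N N', fun i => ?_, fun i => ?_, fun z j => ?_⟩
    · refine Fin.addCases (fun i => ?_) (fun i => ?_) i
      · simpa using hh i
      · simpa using hh' i
    · refine Fin.addCases (fun i => ?_) (fun i => ?_) i
      · simpa using hN i
      · simpa using hN' i
    · have hj : ((j : ℕ) : WithTop ℕ∞) ≤ p := by exact_mod_cast Nat.lt_succ_iff.1 j.2
      have h1 : ContDiff ℝ p fun z : E₁ × E₂ => ∑ i, h i z.1 * N i z.2 := by fun_prop
      have h2 : ContDiff ℝ p fun z : E₁ × E₂ => ∑ i, h' i z.1 * N' i z.2 := by fun_prop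
      simp only [Fin.sum_univ_add, Fin.append_left, Fin.append_right, ContinuousMap.add_apply,
        Jet.add_apply, hA, hB]
      exact (fun_iteratedFDeriv_add_apply (h1.of_le hj).contDiffAt (h2.of_le hj).contDiffAt).symm
  smul_mem' := by
    rintro c A ⟨L, h, N, hh, hN, hA⟩
    refine ⟨L, fun i x => c • h i x, N, fun i => (hh i).const_smul c, hN, fun z j => ?_⟩
    have hj : ((j : ℕ) : WithTop ℕ∞) ≤ p := by exact_mod_cast Nat.lt_succ_iff.1 j.2
    have h1 : ContDiff ℝ p fun z : E₁ × E₂ => ∑ i, h i z.1 * N i z.2 := by fun_prop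
    simp only [smul_mul_assoc, ← Finset.smul_sum, ContinuousMap.smul_apply, Jet.smul_apply, hA]
    exact (iteratedFDeriv_const_smul_apply (a := c) (h1.of_le hj).contDiffAt).symm

variable [FiniteDimensional ℝ E₁] [FiniteDimensional ℝ E₂]

lemma exists_tensor_approx {u : E₁ × E₂ → ℂ} (hu : ContDiff ℝ p u) (huc : HasCompactSupport u)
    {K : Set (E₁ × E₂)} (hK : IsCompact K) {ε : ℝ} (hε : 0 < ε) :
    ∃ (L : ℕ) (h : Fin L → E₁ → ℂ) (N : Fin L → E₂ → ℂ),
      (∀ i, ContDiff ℝ p (h i)) ∧ (∀ i, ContDiff ℝ p (N i)) ∧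
      ∀ z ∈ K, ∀ j ≤ p, ‖iteratedFDeriv ℝ j u z -
        iteratedFDeriv ℝ j (fun z : E₁ × E₂ => ∑ i, h i z.1 * N i z.2) z‖ < ε := by
  have := isCompact_iff_compactSpace.1 hK
  have := FiniteDimensional.proper_real E₁
  have := FiniteDimensional.proper_real E₂
  borelize E₁
  let μ : Measure E₁ := Measure.addHaar
  let A := jetFamily K (p := p) (G := fun q : E₁ × (E₁ × E₂) => u (q.2 + (q.1, 0)))
    (by fun_prop)
  have hconv : ∀ φ : ContDiffBump (0 : E₁),
      (φ.normed μ ⋆[ContinuousLinearMap.lsmul ℝ ℝ, μ] A) 0 ∈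
        (tensorJets p K).topologicalClosure := by
    intro φ
    have hψ : ContDiff ℝ p (φ.normed μ) := φ.contDiff_normed
    have hG₁ : ContDiff ℝ p fun q : E₁ × (E₁ × E₂) =>
      φ.normed μ q.1 • u (q.2 + (0 - q.1, 0)) := by fun_prop
    have hG₂ : ContDiff ℝ p fun q : E₁ × (E₁ × E₂) =>
      φ.normed μ (q.2.1 - q.1) • u (q.1, q.2.2) := by fun_prop
    have hk₁ : IsCompact (tsupport (φ.normed μ)) := φ.hasCompactSupport_normed
    have hk₁' : ∀ s ∉ tsupport (φ.normed μ), ∀ z : E₁ × E₂,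
        φ.normed μ s • u (z + (0 - s, 0)) = 0 := fun s hs z => by
      rw [image_eq_zero_of_notMem_tsupport hs, zero_smul]
    have hk₂ : IsCompact (Prod.fst '' tsupport u) := huc.isCompact.image continuous_fst
    have hk₂' : ∀ s ∉ Prod.fst '' tsupport u, ∀ z : E₁ × E₂,
        φ.normed μ (z.1 - s) • u (s, z.2) = 0 := fun s hs z => by
      rw [image_eq_zero_of_notMem_tsupport fun h => hs ⟨_, h, rfl⟩, smul_zero]
    have h1 : (φ.normed μ ⋆[ContinuousLinearMap.lsmul ℝ ℝ, μ] A) 0 =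
        ∫ s, jetFamily K hG₁ s ∂μ := by
      rw [convolution_lsmul]
      congr 1 with s : 1
      ext z j : 2
      have hus : ContDiff ℝ p fun w : E₁ × E₂ => u (w + (0 - s, 0)) := by fun_prop
      simp only [A, ContinuousMap.smul_apply, Jet.smul_apply, jetFamily_apply]
      refine (iteratedFDeriv_const_smul_apply (ContDiff.contDiffAt ?_)).symm
      exact hus.of_le (by exact_mod_cast Nat.lt_succ_iff.1 j.2)
    have h2 : ∫ s, jetFamily K hG₁ s ∂μ = ∫ s, jetFamily K hG₂ s ∂μ := by
      ext z j : 2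
      rw [integral_jetFamily_apply K hG₁ hk₁ hk₁', integral_jetFamily_apply K hG₂ hk₂ hk₂']
      congr 1 with w
      rw [← integral_sub_left_eq_self _ μ w.1]
      simp [Prod.add_def]
    rw [h1, h2]
    refine Submodule.integral_mem_of_isClosed _ (Submodule.isClosed_topologicalClosure _)
      (integrable_jetFamily K hG₂ hk₂ hk₂') fun s => Submodule.le_topologicalClosure _ ?_
    refine ⟨1, fun _ x => (φ.normed μ (x - s) : ℂ), fun _ y => u (s, y), fun _ => ?_,
      fun _ => by fun_prop, fun z j => by simp⟩
    exact Complex.ofRealCLM.contDiff.comp (by fun_prop : ContDiff ℝ p fun x => φ.normed μ (x - s))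
  have hA : A 0 ∈ (tensorJets p K).topologicalClosure := by
    rw [← SetLike.mem_coe, ← (Submodule.isClosed_topologicalClosure _).closure_eq,
      Metric.mem_closure_iff]
    intro δ hδ
    obtain ⟨r, hr, hAr⟩ := Metric.continuousAt_iff.1 (A.continuous.continuousAt (x := 0))
      (δ / 2) (half_pos hδ)
    let φ : ContDiffBump (0 : E₁) := ⟨r / 2, r, half_pos hr, half_lt_self hr⟩
    refine ⟨_, hconv φ, ?_⟩
    rw [dist_comm]
    refine (φ.dist_normed_convolution_le A.continuous.aestronglyMeasurable
      fun x hx => (hAr hx).le).trans_lt (half_lt_self hδ)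
  obtain ⟨B, ⟨L, h, N, hh, hN, hB⟩, hAB⟩ := Metric.mem_closure_iff.1 hA ε hε
  refine ⟨L, h, N, hh, hN, fun z hz j hj => ?_⟩
  have h1 := ((Jet.norm_apply_le _ ⟨j, Nat.lt_succ_iff.2 hj⟩).trans
    ((A 0 - B).norm_coe_le_norm ⟨z, hz⟩)).trans_lt ((dist_eq_norm (A 0) B) ▸ hAB)
  simpa [A, hB, ← Prod.zero_eq_mk] using h1

lemma exists_contDiff_hasCompactSupport_eventuallyEq {E F : Type*} [NormedAddCommGroup E]
    [NormedSpace ℝ E] [FiniteDimensional ℝ E] [NormedAddCommGroup F] [NormedSpace ℝ F]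
    {K Ω : Set E} (hK : IsCompact K) (hΩ : IsOpen Ω) (hKΩ : K ⊆ Ω) {u : E → F}
    (hu : ContDiffOn ℝ p u Ω) :
    ∃ v : E → F, ContDiff ℝ p v ∧ HasCompactSupport v ∧ ∀ x ∈ K, v =ᶠ[𝓝 x] u := by
  have := FiniteDimensional.proper_real E
  obtain ⟨T, hT, hKT, hTΩ⟩ := exists_compact_between hK hΩ hKΩ
  obtain ⟨χ, hχ1, hχ0, -⟩ := exists_contMDiffMap_one_nhds_of_subset_interior (n := (p : ℕ∞))
    (modelWithCornersSelf ℝ E) hK.isClosed hKT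
  have hχ : ContDiff ℝ p χ := χ.contMDiff.contDiff
  refine ⟨fun x => χ x • u x, contDiff_iff_contDiffAt.2 fun x => ?_,
    HasCompactSupport.intro hT fun x hx => by simp [hχ0 x hx], fun x hx => ?_⟩
  · by_cases hx : x ∈ Ω
    · exact hχ.contDiffAt.smul (hu.contDiffAt (hΩ.mem_nhds hx))
    · refine (contDiffAt_const (c := (0 : F))).congr_of_eventuallyEq ?_
      filter_upwards [hT.isClosed.isOpen_compl.mem_nhds fun h => hx (hTΩ h)] with y hy
      simp [hχ0 y hy]
  · filter_upwards [Filter.Eventually.filter_mono (nhds_le_nhdsSet hx) hχ1] with y hy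
    simp [hy]

end Tensor

/-- **Approximation of a smooth kernel by finite sums of tensor products.**
Let `K₁ ⊂ Ω₁ ⊆ ℝ^{d₁}` and `K₂ ⊂ Ω₂ ⊆ ℝ^{d₂}` with `K₁, K₂` compact and `Ω₁, Ω₂` open,
and let `u : Ω₁ × Ω₂ → ℂ` be `C^p`.  Then for every `ε > 0` there are finitely many `C^p`
functions `h₁,…,h_L` on `Ω₁` and `N₁,…,N_L` on `Ω₂` with
`‖u - Σ_j h_j ⊗ N_j‖_{C^p(K₁ × K₂)} < ε`. -/
theorem tensor_product_approximation (d₁ d₂ p : ℕ) (hd₁ : 1 ≤ d₁) (hd₂ : 1 ≤ d₂)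
    (K₁ : Set (Fin d₁ → ℝ)) (K₂ : Set (Fin d₂ → ℝ))
    (hK₁ : IsCompact K₁) (hK₂ : IsCompact K₂)
    (Ω₁ : Set (Fin d₁ → ℝ)) (Ω₂ : Set (Fin d₂ → ℝ))
    (hΩ₁ : IsOpen Ω₁) (hΩ₂ : IsOpen Ω₂) (hK₁Ω : K₁ ⊆ Ω₁) (hK₂Ω : K₂ ⊆ Ω₂)
    (u : (Fin d₁ → ℝ) × (Fin d₂ → ℝ) → ℂ) (hu : ContDiffOn ℝ p u (Ω₁ ×ˢ Ω₂)) :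
    ∀ ε > (0 : ℝ), ∃ (L : ℕ) (h : Fin L → (Fin d₁ → ℝ) → ℂ) (N : Fin L → (Fin d₂ → ℝ) → ℂ),
      (∀ j, ContDiffOn ℝ p (h j) Ω₁) ∧ (∀ j, ContDiffOn ℝ p (N j) Ω₂) ∧
      CnormWithin (fun z => u z - ∑ j, h j z.1 * N j z.2) (Ω₁ ×ˢ Ω₂) (K₁ ×ˢ K₂) p <
        ENNReal.ofReal ε := by
  intro ε hε
  obtain ⟨v, hv, hvc, hvu⟩ := exists_contDiff_hasCompactSupport_eventuallyEq (hK₁.prod hK₂)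
    (hΩ₁.prod hΩ₂) (prod_mono hK₁Ω hK₂Ω) hu
  obtain ⟨L, h, N, hh, hN, hlt⟩ := exists_tensor_approx hv hvc (hK₁.prod hK₂) (half_pos hε)
  refine ⟨L, h, N, fun j => (hh j).contDiffOn, fun j => (hN j).contDiffOn, ?_⟩
  refine lt_of_le_of_lt (b := ENNReal.ofReal (ε / 2)) ?_
    ((ENNReal.ofReal_lt_ofReal_iff hε).2 (half_lt_self hε))
  refine iSup_le fun j => iSup₂_le fun z hz => ENNReal.ofReal_le_ofReal ?_
  have hj : (j : ℕ) ≤ p := Nat.lt_succ_iff.1 j.2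
  have hj' : ((j : ℕ) : WithTop ℕ∞) ≤ p := by exact_mod_cast hj
  have hs : ContDiff ℝ p fun z : (Fin d₁ → ℝ) × (Fin d₂ → ℝ) => ∑ i, h i z.1 * N i z.2 := by
    fun_prop
  have he : (fun z => u z - ∑ i, h i z.1 * N i z.2) =ᶠ[𝓝 z]
      fun z => v z - ∑ i, h i z.1 * N i z.2 := by
    filter_upwards [hvu z hz] with y hy
    rw [hy]
  rw [iteratedFDerivWithin_of_isOpen _ (hΩ₁.prod hΩ₂) (prod_mono hK₁Ω hK₂Ω hz),
    (he.iteratedFDeriv ℝ j).eq_of_nhds,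
    fun_iteratedFDeriv_sub_apply (hv.of_le hj').contDiffAt (hs.of_le hj').contDiffAt]
  exact (hlt z hz j hj).le
end
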